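/- arXiv:math/0409517 — 6 statements merged into one kernel-verified Lean document; each statement's English description precedes it below -/
import Mathlib

section
/- Let R be a commutative arithmetic ring such that for every maximal ideal M the localization R_M is either an integral domain or a non-coherent ring. Then the λ-dimension of R is at most 2. -/
open DirectSum

universe u

/-- A finite `n`-presentation of an `R`-module `E`: an exact sequence
`F_n → ⋯ → F_1 → F_0 → E → 0` with each `F_i` a finitely generated free module. -/
def HasFiniteNPresentation (R : Type u) [CommRing R] (E : Type u) [AddCommGroup E]
    [Module R E] (n : ℕ) : Prop :=
  ∃ (k : ℕ → ℕ) (f : ∀ i : ℕ, ((Fin (k (i + 1)) → R) →ₗ[R] (Fin (k i) → R)))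
    (g : ((Fin (k 0) → R) →ₗ[R] E)),
    Function.Surjective g ∧
    (0 < n → LinearMap.range (f 0) = LinearMap.ker g) ∧
    (∀ i : ℕ, i + 1 < n → LinearMap.range (f (i + 1)) = LinearMap.ker (f i))

/-- `λ-dim R ≤ n` : every module having a finite `n`-presentation has finite
`m`-presentations for all `m`, i.e. `λ_R(E) ≥ n → λ_R(E) = ∞`. -/
def LambdaDimLE (R : Type u) [CommRing R] (n : ℕ) : Prop :=
  ∀ (E : Type u) [AddCommGroup E] [Module R E],
    HasFiniteNPresentation R E n → ∀ m : ℕ, HasFiniteNPresentation R E m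

/-- `R` is arithmetic: the localization at every maximal ideal is a valuation ring,
i.e. its ideals are totally ordered by inclusion. -/
def IsArithmetic (R : Type u) [CommRing R] : Prop :=
  ∀ (M : Ideal R) (hM : M.IsMaximal),
    letI := hM.isPrime
    ∀ I J : Ideal (Localization.AtPrime M), I ≤ J ∨ J ≤ I

/-- `R` is self fp-injective: `Ext¹_R(F, R) = 0` for every finitely presented module `F`. -/
def SelfFPInjective (R : Type u) [CommRing R] : Prop :=
  ∀ (F : ModuleCat.{u} R), Module.FinitePresentation R F →
    Subsingleton (((Ext R (ModuleCat.{u} R) 1).obj (Opposite.op F)).obj (ModuleCat.of R R))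

/-- A coherent ring: every finitely generated ideal is finitely presented. -/
def IsCoherentRing (R : Type u) [CommRing R] : Prop :=
  ∀ I : Ideal R, I.FG → Module.FinitePresentation R I

/-- flat dimension of `E` at most `n`: the least `m` such that
`Tor_{m+1}(F, E) = 0` for all `F` is at most `n`. -/
def FlatDimLE (R : Type u) [CommRing R] (E : Type u) [AddCommGroup E] [Module R E]
    (n : ℕ) : Prop :=
  ∃ m ≤ n, ∀ (F : Type u) [AddCommGroup F] [Module R F],
    Subsingleton (((CategoryTheory.Tor (ModuleCat.{u} R) (m + 1)).obj (ModuleCat.of R F)).obj (ModuleCat.of R E))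

/-- Hermite ring. -/
def IsHermiteRing (R : Type u) [CommRing R] : Prop :=
  ∀ a b : R, ∃ d a' b' : R, a = d * a' ∧ b = d * b' ∧
    Ideal.span {a'} + Ideal.span {b'} = ⊤

/-- Kaplansky (elementary divisor) ring. -/
def IsKaplanskyRing (R : Type u) [CommRing R] : Prop :=
  ∀ (m n : ℕ) (A : Matrix (Fin m) (Fin n) R),
    ∃ (P : Matrix (Fin m) (Fin m) R) (Q : Matrix (Fin n) (Fin n) R),
      IsUnit P ∧ IsUnit Q ∧ ∀ (i : Fin m) (j : Fin n), (i : ℕ) ≠ (j : ℕ) → (P * A * Q) i j = 0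

/-- Adequate ring. -/
def IsAdequateRing (R : Type u) [CommRing R] : Prop :=
  IsBezout R ∧ ∀ a b : R, a ≠ 0 → ∃ r s : R,
    a = r * s ∧ Ideal.span {r} + Ideal.span {b} = ⊤ ∧
    ∀ s' : R, ¬ IsUnit s' → s' ∣ s → Ideal.span {s'} + Ideal.span {b} ≠ ⊤

/-- The minimal prime spectrum with the subspace topology from `Spec R`. -/
def MinSpec (R : Type u) [CommRing R] : Type u :=
  {P : PrimeSpectrum R // P.asIdeal ∈ minimalPrimes R}

instance (R : Type u) [CommRing R] : TopologicalSpace (MinSpec R) :=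
  instTopologicalSpaceSubtype

/-- Fractionally self fp-injective: for every proper ideal `A`, the classical
quotient ring `Q(R/A)` is self fp-injective. -/
def FractionallySelfFPInjective (R : Type u) [CommRing R] : Prop :=
  ∀ A : Ideal R, A ≠ ⊤ → SelfFPInjective (FractionRing (R ⧸ A))

/-- CF ring: every finite direct sum of cyclic modules has a canonical form. -/
def IsCFRing (R : Type u) [CommRing R] : Prop :=
  ∀ (n : ℕ) (I : Fin n → Ideal R),
    ∃ (m : ℕ) (J : Fin m → Ideal R),
      (∀ i j : Fin m, i ≤ j → J i ≤ J j) ∧ (∀ j : Fin m, J j ≠ ⊤) ∧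
      Nonempty ((⨁ i, R ⧸ I i) ≃ₗ[R] (⨁ j, R ⧸ J j))

section ValuationRing

variable {A : Type u} [CommRing A]

/-- The first factor of a finitely presented product is finitely presented. -/
lemma Module.FinitePresentation.fst_of_prod {P Q : Type*} [AddCommGroup P] [AddCommGroup Q]
    [Module A P] [Module A Q] [Module.FinitePresentation A (P × Q)] :
    Module.FinitePresentation A P := by
  have hQ : Module.Finite A Q :=
    Module.Finite.of_surjective (LinearMap.snd A P Q) LinearMap.snd_surjective
  refine Module.finitePresentation_of_surjective (LinearMap.fst A P Q)
    LinearMap.fst_surjective ?_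
  rw [LinearMap.ker_fst, LinearMap.range_eq_map]
  exact hQ.fg_top.map _

/-- The second factor of a finitely presented product is finitely presented. -/
lemma Module.FinitePresentation.snd_of_prod {P Q : Type*} [AddCommGroup P] [AddCommGroup Q]
    [Module A P] [Module A Q] [Module.FinitePresentation A (P × Q)] :
    Module.FinitePresentation A Q :=
  have := Module.FinitePresentation.of_equiv (LinearEquiv.prodComm A P Q)
  Module.FinitePresentation.fst_of_prod (P := Q) (Q := P)

lemma IsBezout.of_preValuationRing [PreValuationRing A] : IsBezout A := by
  rw [IsBezout.iff_span_pair_isPrincipal]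
  intro x y
  rcases ValuationRing.dvd_total x y with h | h
  · exact ⟨x, by rw [Ideal.submodule_span_eq, Ideal.span_pair_eq_span_left_iff_dvd.mpr h]⟩
  · exact ⟨y, by rw [Ideal.submodule_span_eq, Ideal.span_pair_eq_span_right_iff_dvd.mpr h]⟩

/-- Every element of `A` whose annihilator is finitely generated is zero or regular. -/
def AnnihilatorFGTrivial (A : Type u) [CommRing A] : Prop :=
  ∀ a : A, (LinearMap.ker (LinearMap.toSpanSingleton A A a)).FG →
    a = 0 ∨ ∀ c : A, c * a = 0 → c = 0

/-- In a valuation ring, if `a ≠ 0` has annihilator `(b)` with `b ≠ 0`, then the annihilator of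
`b` is contained in `(a)`. -/
lemma dvd_of_annihilator_eq_span [IsLocalRing A] [PreValuationRing A] {a b : A}
    (ha0 : a ≠ 0) (hb0 : b ≠ 0)
    (hb : ∀ x, x * a = 0 ↔ b ∣ x) {x : A} (hx : x * b = 0) : a ∣ x := by
  have hzero : ∀ p : A, ¬ IsUnit p → ∃ z, z ≠ 0 ∧ z * p = 0 := by
    intro p hp
    by_contra! hreg
    rcases ValuationRing.dvd_total p b with ⟨c, hc⟩ | ⟨c, hc⟩
    · have hca : c * a = 0 := by
        by_contra hne
        refine hreg _ hne ?_
        linear_combination (hb b).mpr dvd_rfl - a * hc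
      obtain ⟨d, hd⟩ := (hb c).mp hca
      have hu : IsUnit (1 - p * d) := by
        rcases IsLocalRing.isUnit_or_isUnit_one_sub_self (p * d) with h | h
        · exact absurd (isUnit_of_mul_isUnit_left h) hp
        · exact h
      refine hb0 (hu.mul_left_eq_zero.mp ?_)
      linear_combination hc + p * hd
    · refine hreg a ha0 ?_
      rw [hc]; linear_combination c * (hb b).mpr dvd_rfl
  by_contra hax
  obtain ⟨y, hy⟩ := (ValuationRing.dvd_total x a).resolve_right hax
  have hyu : ¬ IsUnit y := by
    intro hu
    obtain ⟨v, hv⟩ := hu.exists_right_inv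
    exact hax ⟨v, by linear_combination (-x) * hv - v * hy⟩
  obtain ⟨z, hz0, hz⟩ := hzero y hyu
  rcases ValuationRing.dvd_total x z with ⟨t, ht⟩ | ⟨t, ht⟩
  · obtain ⟨w, hw⟩ := (hb t).mp (by rw [hy]; linear_combination hz - y * ht)
    exact hz0 (by rw [ht, hw]; linear_combination w * hx)
  · exact ha0 (by rw [hy, ht]; linear_combination t * hz)

/-- In a non-coherent valuation ring, every element with finitely generated annihilator
is zero or regular. -/
lemma annihilatorFGTrivial_of_not_coherent [IsLocalRing A] [PreValuationRing A]
    (hA : ¬ IsCoherentRing A) : AnnihilatorFGTrivial A := by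
  have := IsBezout.of_preValuationRing (A := A)
  intro a hfg
  by_contra! hcon
  obtain ⟨ha0, hareg⟩ := hcon
  obtain ⟨b, hb'⟩ := IsBezout.isPrincipal_of_FG _ hfg
  have hb : ∀ x, x * a = 0 ↔ b ∣ x := by
    intro x
    have : x ∈ LinearMap.ker (LinearMap.toSpanSingleton A A a) ↔ x ∈ Submodule.span A {b} := by
      rw [hb']
    simpa [Ideal.mem_span_singleton] using! this
  have hba : b * a = 0 := (hb b).mpr dvd_rfl
  have hb0 : b ≠ 0 := by
    rintro rfl
    obtain ⟨c, hc, hc0⟩ := hareg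
    exact hc0 (zero_dvd_iff.mp ((hb c).mp hc))
  have key : ∀ c : A, ∃ e : A, ∀ x, x * c = 0 ↔ e ∣ x := by
    intro c
    rcases ValuationRing.dvd_total a c with ⟨d, hd⟩ | ⟨d, hd⟩
    · rcases ValuationRing.dvd_total d b with ⟨e, he⟩ | ⟨e, he⟩
      · refine ⟨e, fun x => ⟨fun hx => ?_, ?_⟩⟩
        · obtain ⟨y, hy⟩ := (hb (x * d)).mp (by rw [← hx, hd]; ring)
          have h0 : (x - e * y) * d = 0 := by rw [sub_mul, hy, he]; ring
          rcases ValuationRing.dvd_total e (x - e * y) with ⟨w, hw⟩ | ⟨w, hw⟩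
          · exact ⟨w + y, by linear_combination hw⟩
          · refine absurd ?_ hb0
            rw [he, hw]; linear_combination w * h0
        · rintro ⟨w, rfl⟩
          rw [hd]; linear_combination w * hba - w * a * he
      · refine ⟨1, fun x => ⟨fun _ => one_dvd x, fun _ => ?_⟩⟩
        rw [hd, he]; linear_combination x * e * hba
    · refine ⟨d * b, fun x => ⟨fun hx => ?_, ?_⟩⟩
      · obtain ⟨y, hy⟩ := (hb x).mp (by rw [hd]; linear_combination d * hx)
        rcases ValuationRing.dvd_total d y with ⟨w, hw⟩ | ⟨t, ht⟩
        · exact ⟨w, by rw [hy, hw]; ring⟩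
        · obtain ⟨s, hs⟩ : a ∣ y * c := by
            refine dvd_of_annihilator_eq_span ha0 hb0 hb ?_
            rw [← hx, hy]; ring
          have h1 : y * c * (1 - t * s) = 0 := by
            linear_combination hs + s * hd + s * c * ht
          rcases IsLocalRing.isUnit_or_isUnit_one_sub_self (t * s) with h | h
          · obtain ⟨v, hv⟩ := (isUnit_of_mul_isUnit_left h).exists_right_inv
            exact ⟨v, by rw [hy, ht]; linear_combination (-b * y) * hv⟩
          · refine absurd ?_ ha0
            have h2 : y * c = 0 := h.mul_left_eq_zero.mp h1
            rw [hd, ht]; linear_combination t * h2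
      · rintro ⟨w, rfl⟩
        linear_combination w * hba - w * b * hd
  refine hA fun I hI => ?_
  obtain ⟨c, hc⟩ := IsBezout.isPrincipal_of_FG _ hI
  obtain ⟨e, he⟩ := key c
  have hIc : I = LinearMap.range (LinearMap.toSpanSingleton A A c) := by
    rw [LinearMap.range_toSpanSingleton, hc]
  rw [hIc]
  refine Module.finitePresentation_of_surjective (LinearMap.toSpanSingleton A A c).rangeRestrict
    (LinearMap.surjective_rangeRestrict _) ?_
  rw [LinearMap.ker_rangeRestrict]
  refine ⟨{e}, ?_⟩
  ext x
  simpa [Ideal.mem_span_singleton] using! (he x).symm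

/-- A finitely presented module over a valuation ring that is embedded in a finite free module is
projective as soon as finitely generated annihilators of elements are trivial. -/
lemma projective_of_separating [PreValuationRing A] (hA : AnnihilatorFGTrivial A)
    {ι : Type*} (s : Finset ι) (N : Type u) [AddCommGroup N] [Module A N]
    [Module.FinitePresentation A N] (φ : ι → N →ₗ[A] A)
    (hφ : ∀ x, (∀ i ∈ s, φ i x = 0) → x = 0) : Module.Projective A N := by
  classical
  have := IsBezout.of_preValuationRing (A := A)
  induction s using Finset.strongInduction generalizing N with
  | H s ih =>
    have trivial_case (h : ∀ i ∈ s, φ i = 0) : Module.Projective A N := by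
      have : Subsingleton N := ⟨fun x y => by
        rw [hφ x fun i hi => by simp [h i hi], hφ y fun i hi => by simp [h i hi]]⟩
      infer_instance
    rcases s.eq_empty_or_nonempty with rfl | hs
    · exact trivial_case (by simp)
    obtain ⟨i, hi, hmax⟩ := s.exists_maximalFor (fun i => LinearMap.range (φ i)) hs
    have hle (j) (hj : j ∈ s) : LinearMap.range (φ j) ≤ LinearMap.range (φ i) := by
      rcases (PreValuationRing.iff_ideal_total.mp ‹_›).total
        (LinearMap.range (φ j)) (LinearMap.range (φ i)) with h | h
      · exact h
      · exact hmax hj h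
    obtain ⟨a, ha⟩ := IsBezout.isPrincipal_of_FG (LinearMap.range (φ i)) (by
      rw [LinearMap.range_eq_map]; exact Module.Finite.fg_top.map _)
    have hdvd (j) (hj : j ∈ s) (y : N) : ∃ c, c * a = φ j y := by
      have : φ j y ∈ Submodule.span A {a} := ha ▸ hle j hj ⟨y, rfl⟩
      simpa [Submodule.mem_span_singleton] using this
    obtain ⟨x, hx⟩ : a ∈ LinearMap.range (φ i) := by
      rw [ha]; exact Submodule.mem_span_singleton_self a
    have hker (c : A) : c • x = 0 ↔ c * a = 0 := by
      constructor
      · intro h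
        rw [← hx, ← smul_eq_mul, ← map_smul, h, map_zero]
      · intro h
        refine hφ _ fun j hj => ?_
        obtain ⟨d, hd⟩ := hdvd j hj x
        rw [map_smul, ← hd, smul_eq_mul]
        linear_combination d * h
    set t := LinearMap.toSpanSingleton A N x with ht
    have hcompl : IsCompl (LinearMap.range t) (LinearMap.ker (φ i)) := by
      refine ⟨Submodule.disjoint_def.mpr ?_, codisjoint_iff.mpr (eq_top_iff.mpr fun y _ => ?_)⟩
      · rintro _ ⟨c, rfl⟩ hc
        rw [ht, LinearMap.toSpanSingleton_apply, hker]
        simpa [ht, hx] using hc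
      · obtain ⟨c, hc⟩ := hdvd i hi y
        refine Submodule.mem_sup.mpr ⟨t c, ⟨c, rfl⟩, y - t c, ?_, by abel⟩
        simp [ht, hx, ← hc]
    let e := Submodule.prodEquivOfIsCompl _ _ hcompl
    have := Module.FinitePresentation.of_equiv e.symm
    have h1 : Module.FinitePresentation A (LinearMap.range t) :=
      Module.FinitePresentation.fst_of_prod (Q := LinearMap.ker (φ i))
    have h2 : Module.FinitePresentation A (LinearMap.ker (φ i)) :=
      Module.FinitePresentation.snd_of_prod (P := LinearMap.range t)
    have hfg := Module.FinitePresentation.fg_ker t.rangeRestrict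
      (LinearMap.surjective_rangeRestrict _)
    have hteq : LinearMap.ker t.rangeRestrict =
        LinearMap.ker (LinearMap.toSpanSingleton A A a) := by
      ext c
      simp [ht, hker]
    rcases hA a (hteq ▸ hfg) with rfl | hreg
    · refine trivial_case fun j hj => LinearMap.ext fun y => ?_
      obtain ⟨c, hc⟩ := hdvd j hj y
      simp [← hc]
    · have htinj : Function.Injective t := by
        rw [← LinearMap.ker_eq_bot, LinearMap.ker_eq_bot']
        intro c hc
        exact hreg c ((hker c).mp hc)
      have hp1 : Module.Projective A (LinearMap.range t) :=
        Module.Projective.of_equiv (LinearEquiv.ofInjective t htinj)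
      have hp2 : Module.Projective A (LinearMap.ker (φ i)) := by
        refine ih (s.erase i) (Finset.erase_ssubset hi) _
          (fun j => (φ j).comp (LinearMap.ker (φ i)).subtype) fun y hy => ?_
        refine Subtype.ext (hφ _ fun j hj => ?_)
        by_cases hji : j = i
        · subst hji; exact y.2
        · exact hy j (Finset.mem_erase.mpr ⟨hji, hj⟩)
      exact Module.Projective.of_equiv e

end ValuationRing

lemma annihilatorFGTrivial_of_isDomain (A : Type u) [CommRing A] [IsDomain A] :
    AnnihilatorFGTrivial A := by
  intro a _
  by_cases ha : a = 0
  · exact .inl ha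
  · exact .inr fun c hc => (mul_eq_zero.mp hc).resolve_right ha

lemma projective_of_locally_annihilatorFGTrivial (R : Type u) [CommRing R]
    (hR : IsArithmetic R)
    (h : ∀ (M : Ideal R) (hM : M.IsMaximal),
      letI := hM.isPrime
      AnnihilatorFGTrivial (Localization.AtPrime M))
    {n : ℕ} (N : Submodule R (Fin n → R)) [Module.FinitePresentation R N] :
    Module.Projective R N := by
  refine Module.projective_of_localization_maximal fun M hM => ?_
  have := hM.isPrime
  have : PreValuationRing (Localization.AtPrime M) :=
    PreValuationRing.iff_ideal_total.mpr ⟨hR M hM⟩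
  let g : (Fin n → R) →ₗ[R] (Fin n → Localization.AtPrime M) :=
    .pi fun i => Algebra.linearMap R (Localization.AtPrime M) ∘ₗ .proj i
  have : IsLocalizedModule M.primeCompl g := IsLocalizedModule.pi _ _
  let ψ := IsLocalizedModule.mapExtendScalars M.primeCompl
    (LocalizedModule.mkLinearMap M.primeCompl N) g (Localization.AtPrime M) N.subtype
  have hψ : Function.Injective ψ :=
    IsLocalizedModule.map_injective M.primeCompl _ g N.subtype N.subtype_injective
  refine projective_of_separating (h M hM) Finset.univ _ (fun i => LinearMap.proj i ∘ₗ ψ) ?_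
  intro x hx
  apply hψ
  rw [map_zero]
  ext i
  exact hx i (Finset.mem_univ i)

/-- A presentation whose first syzygy is finitely generated and projective extends to finite
presentations of every length, alternating between two complementary idempotents. -/
lemma HasFiniteNPresentation.of_projective_range {R : Type u} [CommRing R] {E : Type u}
    [AddCommGroup E] [Module R E] {k₀ k₁ : ℕ} (f : (Fin k₁ → R) →ₗ[R] (Fin k₀ → R))
    (g : (Fin k₀ → R) →ₗ[R] E) (hg : Function.Surjective g)
    (hfg : LinearMap.range f = LinearMap.ker g) [Module.Projective R (LinearMap.range f)]
    (m : ℕ) : HasFiniteNPresentation R E m := by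
  obtain ⟨s, hs⟩ := Module.projective_lifting_property f.rangeRestrict LinearMap.id
    (LinearMap.surjective_rangeRestrict _)
  have hs' (y) : f.rangeRestrict (s y) = y := LinearMap.congr_fun hs y
  let q := s ∘ₗ f.rangeRestrict
  have hqq (y) : q (q y) = q y := by simp [q, hs']
  have hfq (y) : f (q y) = f y := congrArg Subtype.val (hs' (f.rangeRestrict y))
  have hrq : LinearMap.range q = LinearMap.ker (LinearMap.id - q) := by
    ext y
    simp only [LinearMap.mem_range, LinearMap.mem_ker, LinearMap.sub_apply, LinearMap.id_apply,
      sub_eq_zero]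
    exact ⟨fun ⟨z, hz⟩ => by rw [← hz, hqq], fun hy => ⟨y, hy.symm⟩⟩
  have hrp : LinearMap.range (LinearMap.id - q) = LinearMap.ker q := by
    ext y
    simp only [LinearMap.mem_range, LinearMap.mem_ker, LinearMap.sub_apply, LinearMap.id_apply]
    exact ⟨fun ⟨z, hz⟩ => by rw [← hz, map_sub, hqq, sub_self], fun hy => ⟨y, by simp [hy]⟩⟩
  have hkq : LinearMap.ker q = LinearMap.ker f := by
    ext y
    simp only [LinearMap.mem_ker]
    refine ⟨fun hy => by rw [← hfq, hy, map_zero], fun hy => ?_⟩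
    have : f.rangeRestrict y = 0 := Subtype.ext hy
    simp [q, this]
  refine ⟨fun i => Nat.casesOn i k₀ fun _ => k₁, fun i => match i with
    | 0 => f
    | j + 1 => if Even j then LinearMap.id - q else q, g, hg, fun _ => hfg, fun i _ => ?_⟩
  rcases i with _ | j
  · simpa using! hrp.trans hkq
  · by_cases hj : Even j
    · simpa [hj, Nat.even_add_one] using! hrq
    · simpa [hj, Nat.even_add_one] using! hrp

/-- An arithmetic ring whose localization at every maximal ideal is a
domain or a non-coherent ring has `λ`-dimension at most 2. -/
theorem lambdaDim_le_two_of_locally_domain_or_noncoherent (R : Type u) [CommRing R]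
    (hR : IsArithmetic R)
    (h : ∀ (M : Ideal R) (hM : M.IsMaximal),
      letI := hM.isPrime
      IsDomain (Localization.AtPrime M) ∨ ¬ IsCoherentRing (Localization.AtPrime M)) :
    LambdaDimLE R 2 := by
  intro E _ _ ⟨k, f, g, hg, h0, h1⟩ m
  have h0 := h0 two_pos
  have hfp : Module.FinitePresentation R (LinearMap.range (f 0)) := by
    refine Module.finitePresentation_of_surjective (f 0).rangeRestrict
      (LinearMap.surjective_rangeRestrict _) ?_
    rw [LinearMap.ker_rangeRestrict, ← h1 0 one_lt_two, LinearMap.range_eq_map]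
    exact Module.Finite.fg_top.map _
  have hproj := projective_of_locally_annihilatorFGTrivial R hR (fun M hM => by
    have := hM.isPrime
    have : PreValuationRing (Localization.AtPrime M) :=
      PreValuationRing.iff_ideal_total.mpr ⟨hR M hM⟩
    rcases h M hM with hd | hc
    · exact annihilatorFGTrivial_of_isDomain _
    · exact annihilatorFGTrivial_of_not_coherent hc) (LinearMap.range (f 0))
  exact HasFiniteNPresentation.of_projective_range (f 0) g hg h0 m
end

section
/- Let R be a valuation ring and A a nonzero proper ideal of R. If A is neither a prime ideal nor a finitely generated ideal, then the λ-dimension of the quotient ring R/A equals 2. -/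
open DirectSum

universe u

section FreeSubmodules

variable {S : Type*} [CommRing S]

/-- In a ring with totally ordered divisibility, a nonempty finite family has a member dividing
all the others. -/
lemma exists_dvd_forall_of_preValuationRing [PreValuationRing S] {ι : Type*} [Finite ι]
    [Nonempty ι] (a : ι → S) : ∃ i, ∀ j, a i ∣ a j := by
  have hd : Directed (fun x y : S ↦ y ∣ x) a := fun i j ↦ by
    rcases ValuationRing.dvd_total (a i) (a j) with h | h
    · exact ⟨i, dvd_rfl, h⟩
    · exact ⟨j, h, dvd_rfl⟩
  have : IsTrans S (fun x y : S ↦ y ∣ x) := ⟨fun _ _ _ h h' ↦ h'.trans h⟩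
  exact hd.finite_le id

/-- The direct summands of a finitely presented internal direct sum are finitely presented. -/
lemma Submodule.finitePresentation_of_disjoint_sup {M : Type*} [AddCommGroup M] [Module S M]
    {P Q : Submodule S M} (hPQ : Disjoint P Q) [Module.FinitePresentation S ↥(P ⊔ Q)]
    (hP : P.FG) (hQ : Q.FG) :
    Module.FinitePresentation S P ∧ Module.FinitePresentation S Q ∧
      Nonempty ((P × Q) ≃ₗ[S] ↥(P ⊔ Q)) := by
  have : Module.Finite S P := .of_fg hP
  have : Module.Finite S Q := .of_fg hQ
  have hinj : Function.Injective (P.subtype.coprod Q.subtype) := by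
    rw [← LinearMap.ker_eq_bot, LinearMap.ker_coprod_of_disjoint_range _ _ (by simpa using hPQ)]
    simp
  let e : (P × Q) ≃ₗ[S] ↥(P ⊔ Q) := (LinearEquiv.ofInjective _ hinj).trans
    (LinearEquiv.ofEq _ _ (by simp [LinearMap.range_coprod]))
  have : Module.FinitePresentation S (P × Q) := .of_equiv e.symm
  exact ⟨Module.finitePresentation_of_split_exact (LinearMap.inl S P Q) (LinearMap.snd S P Q)
      (LinearMap.inr S P Q) (LinearMap.snd_comp_inr ..) LinearMap.inl_injective .inl_snd,
    Module.finitePresentation_of_split_exact (LinearMap.inr S P Q) (LinearMap.fst S P Q)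
      (LinearMap.inl S P Q) (LinearMap.fst_comp_inl ..) LinearMap.inr_injective .inr_fst, ⟨e⟩⟩

/-- Pivot decomposition: subtracting multiples of `v j` from the other vectors does not change
the span. -/
lemma Submodule.span_range_eq_sup_span_sub_smul {M : Type*} [AddCommGroup M] [Module S M]
    {n : ℕ} (v : Fin (n + 1) → M) (j : Fin (n + 1)) (c : Fin n → S) :
    Submodule.span S (Set.range v) = Submodule.span S {v j} ⊔
      Submodule.span S (Set.range fun l ↦ v (j.succAbove l) - c l • v j) := by
  apply le_antisymm
  · rw [Submodule.span_le]
    rintro _ ⟨i, rfl⟩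
    have hj : v j ∈ Submodule.span S {v j} := Submodule.mem_span_singleton_self _
    rcases Fin.eq_self_or_eq_succAbove j i with rfl | ⟨l, rfl⟩
    · exact Submodule.mem_sup_left hj
    · exact Submodule.mem_sup.mpr ⟨_, Submodule.smul_mem _ (c l) hj, _,
        Submodule.subset_span ⟨l, rfl⟩, by simp⟩
  · refine sup_le (Submodule.span_mono (by simp)) (Submodule.span_le.mpr ?_)
    rintro _ ⟨l, rfl⟩
    exact Submodule.sub_mem _ (Submodule.subset_span ⟨_, rfl⟩)
      (Submodule.smul_mem _ _ (Submodule.subset_span ⟨_, rfl⟩))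

/-- Over a ring with totally ordered divisibility in which only zero and the non-zero-divisors
have finitely generated annihilators, every finitely presented submodule of a finite free
module is free. -/
lemma free_span_of_finitePresentation [PreValuationRing S]
    (hann : ∀ s : S, (LinearMap.ker (LinearMap.toSpanSingleton S S s)).FG →
      s = 0 ∨ s ∈ nonZeroDivisors S) {m : ℕ} :
    ∀ {n : ℕ} (v : Fin n → Fin m → S),
      Module.FinitePresentation S (Submodule.span S (Set.range v)) →
      Module.Free S (Submodule.span S (Set.range v)) := by
  intro n
  induction n with
  | zero =>
    intro v _
    have : Subsingleton (Submodule.span S (Set.range v)) := by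
      rw [Set.range_eq_empty, Submodule.span_empty]; infer_instance
    infer_instance
  | succ n ih =>
    intro v hfp
    rcases isEmpty_or_nonempty (Fin m) with hm | hm
    · infer_instance
    obtain ⟨⟨j, i⟩, hdvd⟩ := exists_dvd_forall_of_preValuationRing
      (fun p : Fin (n + 1) × Fin m ↦ v p.1 p.2)
    choose c hc using fun p : Fin (n + 1) × Fin m ↦ hdvd p
    simp only [Prod.forall] at hc
    set w : Fin n → Fin m → S := fun l ↦ v (j.succAbove l) - c (j.succAbove l, i) • v j
    have hspan : Submodule.span S (Set.range v) =
        Submodule.span S {v j} ⊔ Submodule.span S (Set.range w) :=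
      Submodule.span_range_eq_sup_span_sub_smul v j _
    have hw : Submodule.span S (Set.range w) ≤
        LinearMap.ker (LinearMap.proj i : (Fin m → S) →ₗ[S] S) := by
      rw [Submodule.span_le]
      rintro _ ⟨l, rfl⟩
      simp only [w, SetLike.mem_coe, LinearMap.mem_ker, LinearMap.proj_apply, Pi.sub_apply,
        Pi.smul_apply, smul_eq_mul]
      rw [hc (j.succAbove l) i]
      ring
    have hker (s : S) (hs : s * v j i = 0) : s • v j = 0 := by
      ext t
      simp only [Pi.smul_apply, smul_eq_mul, Pi.zero_apply]
      rw [hc j t, ← mul_assoc, hs, zero_mul]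
    have hdisj : Disjoint (Submodule.span S {v j}) (Submodule.span S (Set.range w)) := by
      rw [Submodule.disjoint_def]
      rintro x hx hx'
      obtain ⟨s, rfl⟩ := Submodule.mem_span_singleton.mp hx
      exact hker s (hw hx')
    rw [hspan] at hfp ⊢
    obtain ⟨hP, hQ, ⟨e⟩⟩ := Submodule.finitePresentation_of_disjoint_sup hdisj
      (Submodule.fg_span (Set.finite_singleton _)) (Submodule.fg_span (Set.finite_range _))
    have := ih w hQ
    have hrange := LinearMap.range_toSpanSingleton (R := S) (v j)
    have : Module.Free S (Submodule.span S {v j}) := by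
      rw [← hrange] at hP ⊢
      have hfg := Module.FinitePresentation.fg_ker
        (LinearMap.toSpanSingleton S _ (v j)).rangeRestrict (LinearMap.surjective_rangeRestrict _)
      have hkereq : LinearMap.ker (LinearMap.toSpanSingleton S _ (v j)).rangeRestrict =
          LinearMap.ker (LinearMap.toSpanSingleton S S (v j i)) := by
        ext s
        simp only [LinearMap.ker_rangeRestrict, LinearMap.mem_ker,
          LinearMap.toSpanSingleton_apply, smul_eq_mul]
        exact ⟨fun h ↦ congrFun h i, hker s⟩
      rw [hkereq] at hfg
      rcases hann _ hfg with h0 | hreg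
      · have hv : v j = 0 := by simpa using hker 1 (by simp [h0])
        have : Subsingleton (LinearMap.range (LinearMap.toSpanSingleton S _ (v j))) := by
          rw [hrange, hv, Submodule.span_zero_singleton]; infer_instance
        infer_instance
      · refine Module.Free.of_equiv (LinearEquiv.ofInjective
          (LinearMap.toSpanSingleton S _ (v j)) (LinearMap.ker_eq_bot.mp ?_))
        rw [← LinearMap.ker_rangeRestrict, hkereq, LinearMap.ker_eq_bot']
        exact fun s hs ↦ (mem_nonZeroDivisors_iff.mp hreg).2 s hs
    exact Module.Free.of_equiv e

end FreeSubmodules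

section Presentations

variable {S : Type u} [CommRing S] {E : Type u} [AddCommGroup E] [Module S E]

/-- A module with a finite `2`-presentation is the quotient of a finite free module by a finitely
presented submodule. -/
lemma HasFiniteNPresentation.exists_finitePresentation_ker (h : HasFiniteNPresentation S E 2) :
    ∃ (a b : ℕ) (g : (Fin a → S) →ₗ[S] E) (v : Fin b → Fin a → S), Function.Surjective g ∧
      Submodule.span S (Set.range v) = LinearMap.ker g ∧
      Module.FinitePresentation S (LinearMap.ker g) := by
  obtain ⟨k, f, g, hg, h0, h1⟩ := h
  refine ⟨k 0, k 1, g, fun i ↦ f 0 (Pi.single i 1), hg, ?_, ?_⟩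
  · rw [← h0 two_pos, LinearMap.range_eq_map, ← (Pi.basisFun S (Fin (k 1))).span_eq,
      Submodule.map_span, ← Set.range_comp]
    congr 2
    ext i
    simp
  · rw [← h0 two_pos]
    refine Module.finitePresentation_of_surjective (f 0).rangeRestrict
      (LinearMap.surjective_rangeRestrict _) ?_
    rw [LinearMap.ker_rangeRestrict, ← h1 0 one_lt_two]
    exact Submodule.fg_range _

/-- A quotient of a finite free module by a finite free submodule has finite presentations of
every length. -/
lemma HasFiniteNPresentation.of_free_ker [Nontrivial S] {a : ℕ} (g : (Fin a → S) →ₗ[S] E)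
    (hg : Function.Surjective g) [Module.Free S (LinearMap.ker g)]
    [Module.Finite S (LinearMap.ker g)] (m : ℕ) : HasFiniteNPresentation S E m := by
  let e := (Module.finBasis S (LinearMap.ker g)).equivFun.symm
  set r := Module.finrank S (LinearMap.ker g)
  let k : ℕ → ℕ := fun | 0 => a | 1 => r | _ + 2 => 0
  let f : ∀ i : ℕ, ((Fin (k (i + 1)) → S) →ₗ[S] (Fin (k i) → S)) := fun
    | 0 => (LinearMap.ker g).subtype ∘ₗ e.toLinearMap
    | _ + 1 => 0
  refine ⟨k, f, g, hg, fun _ ↦ ?_, fun i _ ↦ ?_⟩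
  · change LinearMap.range ((LinearMap.ker g).subtype ∘ₗ e.toLinearMap) = _
    rw [LinearMap.range_comp, LinearEquiv.range, Submodule.map_top, Submodule.range_subtype]
  · change LinearMap.range (0 : _ →ₗ[S] _) = _
    rw [LinearMap.range_zero, eq_comm]
    cases i with
    | zero =>
      exact LinearMap.ker_eq_bot.mpr ((LinearMap.ker g).injective_subtype.comp e.injective)
    | succ i =>
      have : Subsingleton (Fin (k (i + 2)) → S) := inferInstanceAs (Subsingleton (Fin 0 → S))
      exact Subsingleton.elim _ _

/-- Schanuel-type lemma for finite presentation: if a surjection from a projective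
module onto `M` has a finitely presented kernel, then so does every surjection from a finite
projective module onto `M`. -/
lemma Module.finitePresentation_ker_of_finitePresentation_ker {R M P Q : Type*} [CommRing R]
    [AddCommGroup M] [AddCommGroup P] [AddCommGroup Q] [Module R M] [Module R P] [Module R Q]
    [Module.Projective R P] [Module.Projective R Q] [Module.Finite R Q]
    (p : P →ₗ[R] M) (hp : Function.Surjective p) (q : Q →ₗ[R] M) (hq : Function.Surjective q)
    [Module.FinitePresentation R (LinearMap.ker p)] :
    Module.FinitePresentation R (LinearMap.ker q) := by
  have := Module.finitePresentation_of_projective R Q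
  obtain ⟨φ, hφ⟩ := Module.projective_lifting_property p q hp
  have hφ' (x : Q) : p (φ x) = q x := DFunLike.congr_fun hφ x
  let ι : LinearMap.ker q →ₗ[R] LinearMap.ker p × Q :=
    ((-φ ∘ₗ (LinearMap.ker q).subtype).codRestrict (LinearMap.ker p)
      fun x ↦ by simp [hφ']).prod (LinearMap.ker q).subtype
  refine Module.finitePresentation_of_projective_of_exact ι
    ((LinearMap.ker p).subtype.coprod φ) ?_ ?_ ?_
  · intro x y h
    exact Subtype.ext (congrArg Prod.snd h)
  · intro x
    obtain ⟨y, hy⟩ := hq (p x)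
    exact ⟨(⟨x - φ y, by simp [hφ', hy]⟩, y), by simp⟩
  · rintro ⟨⟨x, hx⟩, y⟩
    simp only [LinearMap.coprod_apply, Submodule.subtype_apply, Set.mem_range]
    constructor
    · intro h
      have hy : y ∈ LinearMap.ker q := by
        have := congrArg p h
        simpa [hφ', LinearMap.mem_ker.mp hx] using this
      exact ⟨⟨y, hy⟩, Prod.ext (Subtype.ext (eq_neg_of_add_eq_zero_left h).symm) rfl⟩
    · rintro ⟨z, hz⟩
      have h1 := congrArg (fun t ↦ (t.1 : P)) hz
      have h2 := congrArg Prod.snd hz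
      change -φ z = x at h1
      change (z : Q) = y at h2
      rw [← h1, ← h2, neg_add_cancel]

lemma hasFiniteNPresentation_one_quotient_span_singleton (s : S) :
    HasFiniteNPresentation S (S ⧸ Ideal.span {s}) 1 := by
  let u := LinearEquiv.funUnique (Fin 1) S S
  refine ⟨fun _ ↦ 1, fun _ ↦ u.symm.toLinearMap ∘ₗ LinearMap.toSpanSingleton S S s ∘ₗ
    u.toLinearMap, (Ideal.span {s}).mkQ ∘ₗ u.toLinearMap,
    (Submodule.mkQ_surjective _).comp u.surjective, fun _ ↦ ?_, by omega⟩
  rw [LinearMap.ker_comp, Submodule.ker_mkQ, LinearMap.range_comp,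
    LinearMap.range_comp_of_range_eq_top _ u.range, LinearMap.range_toSpanSingleton,
    Submodule.comap_equiv_eq_map_symm]

theorem lambdaDimLE_two [Nontrivial S] [PreValuationRing S]
    (hann : ∀ s : S, (LinearMap.ker (LinearMap.toSpanSingleton S S s)).FG →
      s = 0 ∨ s ∈ nonZeroDivisors S) : LambdaDimLE S 2 := by
  intro E _ _ h m
  obtain ⟨a, b, g, v, hg, hv, hfp⟩ := h.exists_finitePresentation_ker
  have : Module.Free S (LinearMap.ker g) := by
    rw [← hv] at hfp ⊢
    exact free_span_of_finitePresentation hann v hfp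
  exact .of_free_ker g hg m

theorem fg_ker_toSpanSingleton_of_lambdaDimLE_one (h : LambdaDimLE S 1) (s : S) :
    (LinearMap.ker (LinearMap.toSpanSingleton S S s)).FG := by
  obtain ⟨a, b, g, v, hg, hv, hfp⟩ :=
    (h _ (hasFiniteNPresentation_one_quotient_span_singleton s) 2).exists_finitePresentation_ker
  have hfp' := Module.finitePresentation_ker_of_finitePresentation_ker g hg
    (Ideal.span {s}).mkQ (Submodule.mkQ_surjective _)
  rw [Submodule.ker_mkQ, Ideal.span, ← LinearMap.range_toSpanSingleton] at hfp'
  simpa using Module.FinitePresentation.fg_ker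
    (LinearMap.toSpanSingleton S S s).rangeRestrict (LinearMap.surjective_rangeRestrict _)

end Presentations

/-- If `A` is not finitely generated, the nonzero zero divisors of `R ⧸ A` have annihilators which
are not finitely generated. -/
lemma eq_zero_or_mem_nonZeroDivisors_of_fg_ker {R : Type*} [CommRing R]
    (hval : ∀ I J : Ideal R, I ≤ J ∨ J ≤ I) {A : Ideal R} (hAfg : ¬ A.FG) (s : R ⧸ A)
    (hs : (LinearMap.ker (LinearMap.toSpanSingleton (R ⧸ A) (R ⧸ A) s)).FG) :
    s = 0 ∨ s ∈ nonZeroDivisors (R ⧸ A) := by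
  obtain ⟨c, rfl⟩ := Ideal.Quotient.mk_surjective s
  refine or_iff_not_imp_left.mpr fun hc ↦ ?_
  rw [Ideal.Quotient.eq_zero_iff_mem] at hc
  obtain ⟨t, ht⟩ := hs
  classical
  let lift : R ⧸ A → R := Function.surjInv Ideal.Quotient.mk_surjective
  have hlift (x : R ⧸ A) : Ideal.Quotient.mk A (lift x) = x := Function.surjInv_eq _ x
  have hker (x : R) : x * c ∈ A ↔ Ideal.Quotient.mk A x ∈
      LinearMap.ker (LinearMap.toSpanSingleton (R ⧸ A) (R ⧸ A) (Ideal.Quotient.mk A c)) := by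
    rw [LinearMap.mem_ker, LinearMap.toSpanSingleton_apply, smul_eq_mul, ← map_mul,
      Ideal.Quotient.eq_zero_iff_mem]
  let J : Ideal R := Ideal.span (lift '' t)
  have hJ : J.FG := Submodule.fg_span (t.finite_toSet.image _)
  have hJmap : J.map (Ideal.Quotient.mk A) =
      LinearMap.ker (LinearMap.toSpanSingleton (R ⧸ A) (R ⧸ A) (Ideal.Quotient.mk A c)) := by
    rw [← ht, Ideal.map_span, ← Set.image_comp]
    simp [hlift, Ideal.span]
  have hcolon (x : R) : x * c ∈ A ↔ x ∈ J ⊔ A := by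
    rw [hker, ← hJmap, ← Ideal.mem_comap,
      Ideal.comap_map_of_surjective' _ Ideal.Quotient.mk_surjective, Ideal.mk_ker]
  rcases hval J A with h | h
  · rw [sup_eq_right.mpr h] at hcolon
    refine mem_nonZeroDivisors_iff_right.mpr fun x hx ↦ ?_
    obtain ⟨y, rfl⟩ := Ideal.Quotient.mk_surjective x
    rw [← map_mul, Ideal.Quotient.eq_zero_iff_mem] at hx
    exact Ideal.Quotient.eq_zero_iff_mem.mpr ((hcolon y).mp hx)
  · rw [sup_eq_left.mpr h] at hcolon
    refine absurd ?_ hAfg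
    have hAc : A ≤ Ideal.span {c} := (hval A (Ideal.span {c})).resolve_right
      fun h' ↦ hc (h' (Ideal.mem_span_singleton_self c))
    have : A = J * Ideal.span {c} := by
      ext x
      rw [Ideal.mem_mul_span_singleton]
      constructor
      · intro hx
        obtain ⟨y, rfl⟩ := Ideal.mem_span_singleton'.mp (hAc hx)
        exact ⟨y, (hcolon y).mp hx, rfl⟩
      · rintro ⟨y, hy, rfl⟩
        exact (hcolon y).mpr hy
    rw [this]
    exact hJ.mul (Submodule.fg_span_singleton c)

/-- If `A` is a nonzero proper ideal of a valuation ring `R` which is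
neither prime nor finitely generated, then `λ-dim (R/A) = 2`. -/
theorem lambdaDim_quotient_eq_two (R : Type u) [CommRing R] [IsLocalRing R]
    (hval : ∀ I J : Ideal R, I ≤ J ∨ J ≤ I) (A : Ideal R)
    (hA0 : A ≠ ⊥) (hAtop : A ≠ ⊤) (hAprime : ¬ A.IsPrime) (hAfg : ¬ A.FG) :
    LambdaDimLE (R ⧸ A) 2 ∧ ¬ LambdaDimLE (R ⧸ A) 1 := by
  have : Nontrivial (R ⧸ A) := Ideal.Quotient.nontrivial_iff.mpr hAtop
  have : PreValuationRing R := PreValuationRing.iff_ideal_total.mpr ⟨hval⟩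
  have : PreValuationRing (R ⧸ A) :=
    Function.Surjective.preValuationRing (Ideal.Quotient.mk A).toMulHom
      Ideal.Quotient.mk_surjective
  have hann := eq_zero_or_mem_nonZeroDivisors_of_fg_ker hval hAfg
  refine ⟨lambdaDimLE_two hann, fun h ↦ hAprime ?_⟩
  have hreg (s : R ⧸ A) := hann s (fg_ker_toSpanSingleton_of_lambdaDimLE_one h s)
  have : NoZeroDivisors (R ⧸ A) := ⟨fun {x y} hxy ↦ (hreg y).symm.imp
    (fun hy ↦ (mem_nonZeroDivisors_iff.mp hy).2 x hxy) id⟩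
  have : IsDomain (R ⧸ A) := NoZeroDivisors.to_isDomain _
  exact (Ideal.Quotient.isDomain_iff_prime A).mp this
end

section
/- Let R be a commutative arithmetic ring and A a finitely generated proper ideal of R such that the annihilator (0 : A) = {x ∈ R | xA = 0} is contained in the Jacobson radical J(R). Then R/A is a coherent ring and a self fp-injective ring. -/
open DirectSum

universe u

/-- Any two elements are comparable for divisibility locally at every maximal ideal. -/
def LocallyComparable (R : Type*) [CommRing R] : Prop :=
  ∀ M : Ideal R, M.IsMaximal → ∀ a b : R, ∃ s ∉ M, b ∣ s * a ∨ a ∣ s * b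

section

variable {R : Type*} [CommRing R]

theorem Ideal.eq_top_of_forall_isMaximal_exists_notMem {I : Ideal R}
    (h : ∀ M : Ideal R, M.IsMaximal → ∃ s ∈ I, s ∉ M) : I = ⊤ := by
  by_contra hI
  obtain ⟨M, hM, hIM⟩ := I.exists_le_maximal hI
  obtain ⟨s, hs, hsM⟩ := h M hM
  exact hsM (hIM hs)

theorem IsArithmetic.locallyComparable {R : Type u} [CommRing R] (hR : IsArithmetic R) :
    LocallyComparable R := by
  intro M hM
  have key : ∀ a b : R, Ideal.span {algebraMap R (Localization (Ideal.primeCompl M)) a} ≤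
      Ideal.span {algebraMap R (Localization (Ideal.primeCompl M)) b} →
      ∃ s ∉ M, b ∣ s * a := by
    intro a b h
    rw [Ideal.span_singleton_le_span_singleton] at h
    obtain ⟨q, hq⟩ := h
    obtain ⟨⟨r, s⟩, hrs⟩ := IsLocalization.surj (Ideal.primeCompl M) q
    have h' : algebraMap R (Localization (Ideal.primeCompl M)) (s * a) =
        algebraMap R (Localization (Ideal.primeCompl M)) (r * b) := by
      rw [map_mul, map_mul, ← hrs, hq]
      ring
    obtain ⟨t, ht⟩ := (IsLocalization.eq_iff_exists (Ideal.primeCompl M) _).1 h'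
    exact ⟨t * s, (t * s).2, t * r, by linear_combination ht⟩
  intro a b
  rcases hR M hM (Ideal.span {algebraMap R _ a}) (Ideal.span {algebraMap R _ b}) with h | h
  · obtain ⟨s, hs, h⟩ := key a b h
    exact ⟨s, hs, .inl h⟩
  · obtain ⟨s, hs, h⟩ := key b a h
    exact ⟨s, hs, .inr h⟩

theorem LocallyComparable.quotient (h : LocallyComparable R) (A : Ideal R) :
    LocallyComparable (R ⧸ A) := by
  intro M hM a b
  obtain ⟨a, rfl⟩ := Ideal.Quotient.mk_surjective a
  obtain ⟨b, rfl⟩ := Ideal.Quotient.mk_surjective b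
  obtain ⟨s, hs, h⟩ := h (M.comap (Ideal.Quotient.mk A))
    (Ideal.comap_isMaximal_of_surjective _ Ideal.Quotient.mk_surjective) a b
  refine ⟨Ideal.Quotient.mk A s, hs, ?_⟩
  rw [← map_mul, ← map_mul]
  exact h.imp (map_dvd _) (map_dvd _)

/-- Finitely generated ideals are locally principal. -/
theorem LocallyComparable.exists_dvd_smul (h : LocallyComparable R) {M : Ideal R}
    (hM : M.IsMaximal) {I : Ideal R} (hI : I.FG) :
    ∃ b ∈ I, ∃ s ∉ M, ∀ x ∈ I, b ∣ s * x := by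
  induction I, hI using Submodule.fg_induction with
  | singleton b =>
    refine ⟨b, Submodule.mem_span_singleton_self b, 1, hM.isPrime.one_notMem, fun x hx => ?_⟩
    simpa using Ideal.mem_span_singleton.1 hx
  | sup I J _ _ hI hJ =>
    obtain ⟨a, ha, s, hs, hI⟩ := hI
    obtain ⟨b, hb, t, ht, hJ⟩ := hJ
    obtain ⟨r, hr, ⟨d, hd⟩ | ⟨d, hd⟩⟩ := h M hM a b
    · refine ⟨b, Submodule.mem_sup_right hb, r * (s * t),
        hM.isPrime.mul_notMem hr (hM.isPrime.mul_notMem hs ht), fun x hx => ?_⟩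
      obtain ⟨y, hy, z, hz, rfl⟩ := Submodule.mem_sup.1 hx
      obtain ⟨p, hp⟩ := hI y hy
      obtain ⟨q, hq⟩ := hJ z hz
      exact ⟨t * d * p + r * s * q, by
        linear_combination r * t * hp + t * p * hd + r * s * hq⟩
    · refine ⟨a, Submodule.mem_sup_left ha, r * (s * t),
        hM.isPrime.mul_notMem hr (hM.isPrime.mul_notMem hs ht), fun x hx => ?_⟩
      obtain ⟨y, hy, z, hz, rfl⟩ := Submodule.mem_sup.1 hx
      obtain ⟨p, hp⟩ := hI y hy
      obtain ⟨q, hq⟩ := hJ z hz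
      exact ⟨s * d * q + r * t * p, by
        linear_combination r * s * hq + s * q * hd + r * t * hp⟩

/-- A local form of cancellation: if `β * γ` is nonzero locally at `M`, then the elements
killed by `β` are locally multiples of `γ`. -/
theorem LocallyComparable.exists_dvd_mul_of_mul_eq_zero (h : LocallyComparable R) {M : Ideal R}
    (hM : M.IsMaximal) {β γ t : R} (hβγ : ∀ u ∉ M, u * (β * γ) ≠ 0) (ht : β * t = 0) :
    ∃ w ∉ M, γ ∣ w * t := by
  obtain ⟨w, hw, hd | ⟨d, hd⟩⟩ := h M hM t γ
  · exact ⟨w, hw, hd⟩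
  · exact absurd (by linear_combination β * hd + d * ht) (hβγ w hw)

theorem mul_ne_zero_of_annihilator_le_jacobson {A : Ideal R}
    (hann : Submodule.annihilator A ≤ Ideal.jacobson (⊥ : Ideal R)) {M : Ideal R}
    (hM : M.IsMaximal) {a s : R} (hs : s ∉ M) (hA : ∀ x ∈ A, a ∣ s * x) :
    ∀ t ∉ M, t * a ≠ 0 := by
  intro t ht hta
  refine hM.isPrime.mul_notMem ht hs ((Ideal.mem_sInf.1 (hann ?_)) ⟨bot_le, hM⟩)
  rw [Submodule.mem_annihilator]
  intro x hx
  obtain ⟨d, hd⟩ := hA x hx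
  rw [smul_eq_mul]
  linear_combination t * hd + d * hta

/-- A finitely generated ideal `A` contained in `B` locally at every maximal ideal factors
through a finitely generated subideal of `(A : b)`. -/
theorem LocallyComparable.exists_fg_le_mul (h : LocallyComparable R) {A : Ideal R}
    (hfg : A.FG) (b : R) :
    ∃ C : Ideal R, C.FG ∧ (∀ c ∈ C, b * c ∈ A) ∧ A ≤ (A ⊔ Ideal.span {b}) * C := by
  let I : Ideal R :=
    { carrier := {s | ∃ C : Ideal R, C.FG ∧ (∀ c ∈ C, b * c ∈ A) ∧
        ∀ x ∈ A, s * x ∈ (A ⊔ Ideal.span {b}) * C}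
      zero_mem' := ⟨⊥, Submodule.fg_bot, by simp, by simp⟩
      add_mem' := by
        rintro s t ⟨C, hC, hCA, hs⟩ ⟨D, hD, hDA, ht⟩
        refine ⟨C ⊔ D, Submodule.FG.sup hC hD, fun c hc => ?_, fun x hx => ?_⟩
        · obtain ⟨y, hy, z, hz, rfl⟩ := Submodule.mem_sup.1 hc
          rw [mul_add]
          exact A.add_mem (hCA y hy) (hDA z hz)
        · rw [add_mul]
          exact Ideal.add_mem _ (Ideal.mul_mono_right le_sup_left (hs x hx))
            (Ideal.mul_mono_right le_sup_right (ht x hx))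
      smul_mem' := by
        rintro r s ⟨C, hC, hCA, hs⟩
        refine ⟨C, hC, hCA, fun x hx => ?_⟩
        rw [smul_eq_mul, mul_assoc]
        exact Ideal.mul_mem_left _ _ (hs x hx) }
  have hI : I = ⊤ := by
    refine Ideal.eq_top_of_forall_isMaximal_exists_notMem fun M hM => ?_
    obtain ⟨a, haA, s, hs, hA⟩ := h.exists_dvd_smul hM hfg
    obtain ⟨r, hr, ⟨c, hc⟩ | ⟨c, hc⟩⟩ := h M hM a b
    · refine ⟨r * s, ⟨Ideal.span {c}, Submodule.fg_span_singleton c, fun y hy => ?_,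
        fun x hx => ?_⟩, hM.isPrime.mul_notMem hr hs⟩
      · obtain ⟨d, rfl⟩ := Ideal.mem_span_singleton.1 hy
        rw [← mul_assoc, ← hc]
        exact A.mul_mem_right _ (A.mul_mem_left _ haA)
      · obtain ⟨d, hd⟩ := hA x hx
        have : r * s * x = b * (d * c) := by linear_combination r * hd + d * hc
        rw [this]
        exact Ideal.mul_mem_mul (Ideal.mem_sup_right (Ideal.mem_span_singleton_self b))
          (Ideal.mem_span_singleton.2 (Dvd.intro_left d rfl))
    · refine ⟨r, ⟨Ideal.span {r}, Submodule.fg_span_singleton r, fun y hy => ?_,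
        fun x hx => ?_⟩, hr⟩
      · obtain ⟨d, rfl⟩ := Ideal.mem_span_singleton.1 hy
        rw [← mul_assoc, mul_comm b, hc]
        exact A.mul_mem_right _ (A.mul_mem_right _ haA)
      · rw [mul_comm r x]
        exact Ideal.mul_mem_mul (Ideal.mem_sup_left hx) (Ideal.mem_span_singleton_self r)
  obtain ⟨C, hC, hCA, hs⟩ := (Ideal.eq_top_iff_one I).1 hI
  exact ⟨C, hC, hCA, fun x hx => by simpa using hs x hx⟩

/-- Principal ideals of the quotient have finitely generated annihilators. -/
theorem LocallyComparable.ker_toSpanSingleton_quotient_fg (h : LocallyComparable R)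
    {A : Ideal R} (hfg : A.FG)
    (hann : Submodule.annihilator A ≤ Ideal.jacobson (⊥ : Ideal R)) (b : R ⧸ A) :
    (LinearMap.ker (LinearMap.toSpanSingleton (R ⧸ A) (R ⧸ A) b)).FG := by
  obtain ⟨b, rfl⟩ := Ideal.Quotient.mk_surjective b
  obtain ⟨C, hC, hCA, hAC⟩ := h.exists_fg_le_mul hfg b
  suffices hle : ∀ x, b * x ∈ A → x ∈ C by
    have : LinearMap.ker (LinearMap.toSpanSingleton (R ⧸ A) (R ⧸ A) (Ideal.Quotient.mk A b)) =
        C.map (Ideal.Quotient.mk A) := by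
      ext x
      obtain ⟨x, rfl⟩ := Ideal.Quotient.mk_surjective x
      rw [LinearMap.mem_ker, LinearMap.toSpanSingleton_apply, smul_eq_mul, ← map_mul,
        Ideal.Quotient.eq_zero_iff_mem, mul_comm]
      refine ⟨fun hx => Ideal.mem_map_of_mem _ (hle x hx), fun hx => ?_⟩
      obtain ⟨c, hc, hcx⟩ :=
        (Ideal.mem_map_iff_of_surjective _ Ideal.Quotient.mk_surjective).1 hx
      have := A.add_mem (A.mul_mem_left (-b) (Ideal.Quotient.eq.1 hcx)) (hCA c hc)
      convert this using 1
      ring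
    rw [this]
    exact hC.map _
  intro x hx
  let I : Ideal R := C.colon {x}
  have hI : ∀ w, w ∈ I ↔ w * x ∈ C := fun w => by
    rw [Submodule.mem_colon_singleton, smul_eq_mul]
  have hBA : ∀ y ∈ A ⊔ Ideal.span {b}, x * y ∈ A := by
    intro y hy
    obtain ⟨a, ha, z, hz, rfl⟩ := Submodule.mem_sup.1 hy
    obtain ⟨d, rfl⟩ := Ideal.mem_span_singleton.1 hz
    have := A.add_mem (A.mul_mem_left x ha) (A.mul_mem_left d hx)
    convert this using 1
    ring
  suffices I = ⊤ by simpa using (hI 1).1 (this ▸ Submodule.mem_top)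
  refine Ideal.eq_top_of_forall_isMaximal_exists_notMem fun M hM => ?_
  obtain ⟨β, hβ, s, hs, hB⟩ :=
    h.exists_dvd_smul hM (Submodule.FG.sup hfg (Submodule.fg_span_singleton b))
  obtain ⟨γ, hγ, t, ht, hC'⟩ := h.exists_dvd_smul hM hC
  have hAβγ : ∀ x ∈ A, β * γ ∣ (s * t) * x := by
    intro x hx
    refine Submodule.mul_induction_on (hAC hx) (fun y hy z hz => ?_) (fun y z hy hz => ?_)
    · rw [mul_mul_mul_comm]
      exact mul_dvd_mul (hB y hy) (hC' z hz)
    · rw [mul_add]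
      exact dvd_add hy hz
  obtain ⟨d, hd⟩ := hAβγ _ (hBA β hβ)
  obtain ⟨w, hw, hdvd⟩ := h.exists_dvd_mul_of_mul_eq_zero hM (t := s * t * x - d * γ)
    (mul_ne_zero_of_annihilator_le_jacobson hann hM (hM.isPrime.mul_notMem hs ht) hAβγ)
    (by linear_combination hd)
  refine ⟨w * (s * t), (hI _).2 ?_, hM.isPrime.mul_notMem hw (hM.isPrime.mul_notMem hs ht)⟩
  have := dvd_add hdvd (Dvd.intro (w * d) rfl : γ ∣ γ * (w * d))
  refine C.mem_of_dvd ?_ hγ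
  convert this using 1
  ring

/-- Principal ideals of the quotient are annihilator ideals. -/
theorem LocallyComparable.dvd_quotient_of_forall_mul_eq_zero (h : LocallyComparable R)
    {A : Ideal R} (hfg : A.FG)
    (hann : Submodule.annihilator A ≤ Ideal.jacobson (⊥ : Ideal R)) (b y : R ⧸ A)
    (hby : ∀ c, c * b = 0 → c * y = 0) : b ∣ y := by
  obtain ⟨b, rfl⟩ := Ideal.Quotient.mk_surjective b
  obtain ⟨y, rfl⟩ := Ideal.Quotient.mk_surjective y
  replace hby : ∀ c, c * b ∈ A → c * y ∈ A := fun c hc => by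
    rw [← Ideal.Quotient.eq_zero_iff_mem, map_mul] at hc ⊢
    exact hby _ hc
  let I : Ideal R := (A ⊔ Ideal.span {b}).colon {y}
  have hI : ∀ w, w ∈ I ↔ w * y ∈ A ⊔ Ideal.span {b} := fun w => by
    rw [Submodule.mem_colon_singleton, smul_eq_mul]
  suffices hItop : I = ⊤ by
    have hy : y ∈ A ⊔ Ideal.span {b} := by simpa using (hI 1).1 (hItop ▸ Submodule.mem_top)
    obtain ⟨a, ha, z, hz, rfl⟩ := Submodule.mem_sup.1 hy
    rw [map_add, Ideal.Quotient.eq_zero_iff_mem.2 ha, zero_add]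
    exact map_dvd _ (Ideal.mem_span_singleton.1 hz)
  refine Ideal.eq_top_of_forall_isMaximal_exists_notMem fun M hM => ?_
  obtain ⟨a, haA, s, hs, hA⟩ := h.exists_dvd_smul hM hfg
  have hne := mul_ne_zero_of_annihilator_le_jacobson hann hM hs hA
  obtain ⟨r, hr, ⟨c, hc⟩ | ⟨c, hc⟩⟩ := h M hM a b
  · obtain ⟨d, hd⟩ := hA _ (hby c (by
      rw [mul_comm, ← hc]
      exact A.mul_mem_left _ haA))
    obtain ⟨w, hw, hdvd⟩ := h.exists_dvd_mul_of_mul_eq_zero hM (β := c) (γ := b)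
      (t := r * s * y - b * d)
      (fun u hu h0 => hne (u * r) (hM.isPrime.mul_notMem hu hr)
        (by linear_combination h0 + u * hc))
      (by linear_combination r * hd + d * hc)
    refine ⟨w * (r * s), (hI _).2 (Ideal.mem_sup_right (Ideal.mem_span_singleton.2 ?_)),
      hM.isPrime.mul_notMem hw (hM.isPrime.mul_notMem hr hs)⟩
    have := dvd_add hdvd (Dvd.intro (w * d) rfl : b ∣ b * (w * d))
    convert this using 1
    ring
  · exact ⟨r, (hI _).2 (Ideal.mem_sup_left (hby r (hc ▸ A.mul_mem_right _ haA))), hr⟩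

/-- A locally comparable ring whose elements have finitely generated annihilators is
coherent. -/
theorem LocallyComparable.isCoherentRing {S : Type u} [CommRing S] (h : LocallyComparable S)
    (hker : ∀ b : S, (LinearMap.ker (LinearMap.toSpanSingleton S S b)).FG) :
    IsCoherentRing S := by
  intro I hI
  have : Module.Finite S I := Module.Finite.iff_fg.2 hI
  obtain ⟨n, f, hf⟩ := Module.Finite.exists_fin' S I
  refine Module.finitePresentation_of_free_of_surjective f hf ?_
  let K := LinearMap.ker f
  let L : Ideal S :=
    { carrier := {s | ∃ N : Submodule S (Fin n → S), N.FG ∧ N ≤ K ∧ ∀ x ∈ K, s • x ∈ N}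
      zero_mem' := ⟨⊥, Submodule.fg_bot, bot_le, by simp⟩
      add_mem' := by
        rintro s t ⟨N, hN, hNK, hs⟩ ⟨P, hP, hPK, ht⟩
        refine ⟨N ⊔ P, hN.sup hP, sup_le hNK hPK, fun x hx => ?_⟩
        rw [add_smul]
        exact Submodule.add_mem_sup (hs x hx) (ht x hx)
      smul_mem' := by
        rintro r s ⟨N, hN, hNK, hs⟩
        refine ⟨N, hN, hNK, fun x hx => ?_⟩
        rw [smul_assoc]
        exact N.smul_mem _ (hs x hx) }
  have hL : L = ⊤ := by
    refine Ideal.eq_top_of_forall_isMaximal_exists_notMem fun M hM => ?_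
    obtain ⟨b, hb, s, hs, hsI⟩ := h.exists_dvd_smul hM hI
    obtain ⟨e, he⟩ := hf ⟨b, hb⟩
    choose d hd using fun i => hsI (f (Pi.single i 1)) (f (Pi.single i 1)).2
    let v : Fin n → Fin n → S := fun i => s • Pi.single i 1 - d i • e
    have hv : ∀ i, f (v i) = 0 := fun i => by
      ext
      simp [v, he, hd, mul_comm]
    have hsum : ∀ x : Fin n → S, s • x = ∑ i, x i • v i + (∑ i, x i * d i) • e := by
      intro x
      ext j
      have : ∑ i, x i * (d i * e j) = (∑ i, x i * d i) * e j := by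
        simp only [Finset.sum_mul, mul_assoc]
      simp [v, Pi.single_apply, mul_sub, this, mul_comm s]
    refine ⟨s, ⟨Submodule.span S (Set.range v) ⊔
      (LinearMap.ker (LinearMap.toSpanSingleton S S b)).map
        (LinearMap.toSpanSingleton S (Fin n → S) e),
      (Submodule.fg_span (Set.finite_range v)).sup ((hker b).map _), sup_le ?_ ?_,
      fun x hx => ?_⟩, hs⟩
    · rw [Submodule.span_le]
      rintro _ ⟨i, rfl⟩
      exact hv i
    · rintro _ ⟨c, hc, rfl⟩
      rw [LinearMap.mem_ker]
      ext
      simpa [he] using hc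
    · have hx' : f x = 0 := hx
      have h0 := congrArg f (hsum x)
      simp only [map_smul, map_add, map_sum, hv, hx', smul_zero, Finset.sum_const_zero,
        zero_add, he] at h0
      rw [hsum x]
      refine Submodule.add_mem_sup (Submodule.sum_mem _ fun i _ =>
        Submodule.smul_mem _ _ (Submodule.subset_span ⟨i, rfl⟩)) ⟨∑ i, x i * d i, ?_, rfl⟩
      exact (congrArg Subtype.val h0).symm
  obtain ⟨N, hN, hNK, hs⟩ := (Ideal.eq_top_iff_one L).1 hL
  rwa [show LinearMap.ker f = N from le_antisymm (fun x hx => by simpa using hs x hx) hNK]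

/-- If principal ideals are annihilator ideals, linear forms on finitely generated ideals
extend. -/
theorem LocallyComparable.exists_mul_extend (h : LocallyComparable R)
    (hdvd : ∀ b y : R, (∀ c, c * b = 0 → c * y = 0) → b ∣ y) {I : Ideal R} (hI : I.FG)
    (φ : I →ₗ[R] R) : ∃ z, ∀ x : I, φ x = x * z := by
  let L : Ideal R :=
    { carrier := {s | ∃ z, ∀ x : I, s * φ x = x * z}
      zero_mem' := ⟨0, by simp⟩
      add_mem' := by
        rintro s t ⟨y, hy⟩ ⟨z, hz⟩
        exact ⟨y + z, fun x => by rw [add_mul, mul_add, hy, hz]⟩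
      smul_mem' := by
        rintro r s ⟨z, hz⟩
        exact ⟨r * z, fun x => by rw [smul_eq_mul, mul_assoc, hz, mul_left_comm]⟩ }
  have hL : L = ⊤ := by
    refine Ideal.eq_top_of_forall_isMaximal_exists_notMem fun M hM => ?_
    obtain ⟨b, hb, s, hs, hsI⟩ := h.exists_dvd_smul hM hI
    obtain ⟨z, hz⟩ := hdvd b (φ ⟨b, hb⟩) fun c hc => by
      rw [← smul_eq_mul, ← map_smul, show c • (⟨b, hb⟩ : I) = 0 from Subtype.ext hc, map_zero]
    refine ⟨s, ⟨s * z, fun x => ?_⟩, hs⟩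
    obtain ⟨d, hd⟩ := hsI x x.2
    have : s • x = d • (⟨b, hb⟩ : I) := Subtype.ext (hd.trans (mul_comm b d))
    rw [← smul_eq_mul, ← map_smul, this, map_smul, hz, smul_eq_mul]
    linear_combination -z * hd
  obtain ⟨z, hz⟩ := (Ideal.eq_top_iff_one L).1 hL
  exact ⟨z, fun x => by simpa using hz x⟩


/-- A linear form on the domain of `p` that kills the kernel of `p` factors through the range
of `p`. -/
theorem LinearMap.exists_comp_rangeRestrict_eq {M N P : Type*} [AddCommGroup M] [Module R M]
    [AddCommGroup N] [Module R N] [AddCommGroup P] [Module R P] (p : M →ₗ[R] N)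
    (f : M →ₗ[R] P) (h : LinearMap.ker p ≤ LinearMap.ker f) :
    ∃ θ : LinearMap.range p →ₗ[R] P, ∀ x, θ (p.rangeRestrict x) = f x := by
  refine ⟨(LinearMap.ker p).liftQ f h ∘ₗ p.quotKerEquivRange.symm.toLinearMap, fun x => ?_⟩
  have : p.quotKerEquivRange.symm (p.rangeRestrict x) = (LinearMap.ker p).mkQ x := by
    rw [LinearEquiv.symm_apply_eq]
    ext
    simp
  simp [this]

/-- Over a coherent ring, if linear forms on finitely generated ideals extend to the ring, then
linear forms on finitely generated submodules of finite free modules extend. -/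
theorem IsCoherentRing.exists_extend {S : Type u} [CommRing S] (hS : IsCoherentRing S)
    (hext : ∀ I : Ideal S, I.FG → ∀ φ : I →ₗ[S] S, ∃ z, ∀ x : I, φ x = x * z) (n : ℕ)
    (K : Submodule S (Fin n → S)) (hK : K.FG) (φ : K →ₗ[S] S) :
    ∃ ψ : (Fin n → S) →ₗ[S] S, ∀ x : K, ψ x = φ x := by
  induction n with
  | zero =>
    refine ⟨0, fun x => ?_⟩
    rw [Subsingleton.elim x 0, map_zero]
    rfl
  | succ n ih =>
    have : Module.Finite S K := Module.Finite.iff_fg.2 hK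
    let p : K →ₗ[S] S := LinearMap.proj 0 ∘ₗ K.subtype
    let T : (Fin (n + 1) → S) →ₗ[S] (Fin n → S) := LinearMap.funLeft S S Fin.succ
    let j : (Fin n → S) →ₗ[S] (Fin (n + 1) → S) := LinearMap.vecCons 0 LinearMap.id
    have hTj : ∀ x, T (j x) = x := fun x => rfl
    have hjT : ∀ x, x 0 = 0 → j (T x) = x := fun x hx => by
      ext i
      refine Fin.cases ?_ (fun i => ?_) i
      · simp [j, hx]
      · simp [j, T]
    have hI : (LinearMap.range p).FG := Module.Finite.iff_fg.1 inferInstance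
    have := hS _ hI
    have hker : (LinearMap.ker p).FG := by
      rw [← LinearMap.ker_rangeRestrict]
      exact Module.FinitePresentation.fg_ker _ p.surjective_rangeRestrict
    have hK' : K.comap j = (LinearMap.ker p).map (T ∘ₗ K.subtype) := by
      ext x
      refine ⟨fun hx => ⟨⟨j x, hx⟩, ?_, hTj x⟩, ?_⟩
      · simp [p, j]
      · rintro ⟨k, hk, rfl⟩
        simp only [Submodule.mem_comap, LinearMap.comp_apply, Submodule.subtype_apply]
        rw [hjT _ hk]
        exact k.2
    obtain ⟨ψ, hψ⟩ := ih (K.comap j) (hK' ▸ hker.map _)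
      (φ ∘ₗ j.restrict (p := K.comap j) (q := K) fun _ hx => hx)
    obtain ⟨θ, hθ⟩ := p.exists_comp_rangeRestrict_eq (φ - ψ ∘ₗ T ∘ₗ K.subtype) (by
      intro k hk
      have hk' : j (T k) = k := hjT _ hk
      have := hψ ⟨T k, by rw [Submodule.mem_comap, hk']; exact k.2⟩
      rw [LinearMap.mem_ker, LinearMap.sub_apply, sub_eq_zero]
      refine Eq.trans ?_ this.symm
      exact congrArg φ (Subtype.ext hk'.symm))
    obtain ⟨z, hz⟩ := hext _ hI θ
    refine ⟨ψ ∘ₗ T + z • LinearMap.proj 0, fun x => ?_⟩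
    have h1 := hθ x
    rw [hz] at h1
    have h2 : x.1 0 * z = φ x - ψ (T x) := h1
    simp only [LinearMap.add_apply, LinearMap.comp_apply, LinearMap.smul_apply,
      LinearMap.proj_apply, smul_eq_mul]
    linear_combination h2

/-- The extension property for finitely generated submodules of finite free modules passes to
the kernel of any surjection from a projective module onto a finitely presented module. -/
theorem exists_extend_of_projective {N : Type*} [AddCommGroup N] [Module R N]
    (hext : ∀ (n : ℕ) (K : Submodule R (Fin n → R)), K.FG → ∀ φ : K →ₗ[R] N,
      ∃ ψ : (Fin n → R) →ₗ[R] N, ∀ x : K, ψ x = φ x)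
    {F P : Type*} [AddCommGroup F] [Module R F] [Module.FinitePresentation R F]
    [AddCommGroup P] [Module R P] [Module.Projective R P] (π : P →ₗ[R] F)
    (hπ : Function.Surjective π) (f : LinearMap.ker π →ₗ[R] N) :
    ∃ g : P →ₗ[R] N, ∀ x : LinearMap.ker π, g x = f x := by
  obtain ⟨n, q, hq⟩ := Module.Finite.exists_fin' R F
  obtain ⟨α, hα⟩ := Module.projective_lifting_property π q hπ
  obtain ⟨β, hβ⟩ := Module.projective_lifting_property q π hq
  replace hα : ∀ x, π (α x) = q x := LinearMap.congr_fun hα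
  replace hβ : ∀ x, q (β x) = π x := LinearMap.congr_fun hβ
  let α' : LinearMap.ker q →ₗ[R] LinearMap.ker π := α.restrict fun x hx => by
    rw [LinearMap.mem_ker, hα]
    exact hx
  obtain ⟨ψ, hψ⟩ := hext n _ (Module.FinitePresentation.fg_ker q hq) (f ∘ₗ α')
  let δ : P →ₗ[R] LinearMap.ker π := (LinearMap.id - α ∘ₗ β).codRestrict _ fun x => by
    simp [hα, hβ]
  refine ⟨ψ ∘ₗ β + f ∘ₗ δ, fun x => ?_⟩
  have hx : β x ∈ LinearMap.ker q := by
    rw [LinearMap.mem_ker, hβ]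
    exact x.2
  have h1 : ψ (β x) = f (α' ⟨β x, hx⟩) := hψ ⟨β x, hx⟩
  rw [LinearMap.add_apply, LinearMap.comp_apply, LinearMap.comp_apply, h1, ← map_add]
  congr 1
  ext
  simp [α', δ]

open CategoryTheory in
theorem selfFPInjective_of_exists_extend {S : Type u} [CommRing S]
    (hext : ∀ (n : ℕ) (K : Submodule S (Fin n → S)), K.FG → ∀ φ : K →ₗ[S] S,
      ∃ ψ : (Fin n → S) →ₗ[S] S, ∀ x : K, ψ x = φ x) :
    SelfFPInjective S := by
  intro F hF
  let P := ProjectiveResolution.of F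
  suffices h : Limits.IsZero
      (((Ext S (ModuleCat.{u} S) 1).obj (Opposite.op F)).obj (ModuleCat.of S S)) from
    ModuleCat.subsingleton_of_isZero h
  refine Limits.IsZero.of_iso ?_ (P.isoExt 1 (ModuleCat.of S S))
  rw [← HomologicalComplex.exactAt_iff_isZero_homology,
    HomologicalComplex.exactAt_iff' _ 0 1 2 (by simp) (by simp),
    ShortComplex.moduleCat_exact_iff]
  intro (x : P.complex.X 1 ⟶ ModuleCat.of S S) hx
  replace hx : P.complex.d 2 1 ≫ x = 0 := hx
  have hP : Module.Projective S (P.complex.X 0) :=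
    (IsProjective.iff_projective _).2 (P.projective 0)
  have hexact₀ := P.exact₀.moduleCat_range_eq_ker
  have hexact₁ := (P.exact_succ 0).moduleCat_range_eq_ker
  have hπ : Function.Surjective (P.π.f 0).hom :=
    (ModuleCat.epi_iff_surjective _).1 inferInstance
  obtain ⟨θ, hθ⟩ := (P.complex.d 1 0).hom.exists_comp_rangeRestrict_eq x.hom (by
    intro k hk
    obtain ⟨l, rfl⟩ := hexact₁.ge hk
    exact LinearMap.congr_fun (congrArg ModuleCat.Hom.hom hx) l)
  have : Module.FinitePresentation S (((ChainComplex.single₀ (ModuleCat S)).obj F).X 0) := hF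
  obtain ⟨g, hg⟩ := exists_extend_of_projective hext (P.π.f 0).hom hπ
    (θ ∘ₗ Submodule.inclusion hexact₀.ge)
  refine ⟨ModuleCat.ofHom g, ?_⟩
  change P.complex.d 1 0 ≫ ModuleCat.ofHom g = x
  ext y
  exact (hg ⟨_, hexact₀.le ⟨y, rfl⟩⟩).trans (hθ y)

end

/-- If `A` is a finitely generated proper ideal of an arithmetic ring `R`
with `(0 : A) ⊆ J(R)`, then `R/A` is coherent and self fp-injective. -/
theorem quotient_coherent_and_selfFPInjective (R : Type u) [CommRing R]
    (hR : IsArithmetic R) (A : Ideal R) (hfg : A.FG) (hAtop : A ≠ ⊤)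
    (hann : Submodule.annihilator A ≤ Ideal.jacobson (⊥ : Ideal R)) :
    IsCoherentRing (R ⧸ A) ∧ SelfFPInjective (R ⧸ A) := by
  have hlc := hR.locallyComparable
  have hcoh : IsCoherentRing (R ⧸ A) :=
    (hlc.quotient A).isCoherentRing (hlc.ker_toSpanSingleton_quotient_fg hfg hann)
  exact ⟨hcoh, selfFPInjective_of_exists_extend (hcoh.exists_extend fun _ hI φ =>
    (hlc.quotient A).exists_mul_extend (hlc.dvd_quotient_of_forall_mul_eq_zero hfg hann) hI φ)⟩
end

section
/- Let R be a commutative CF-ring. Then the λ-dimension of R is at most 2, and R is coherent if and only if R_M is coherent for every maximal ideal M of R. -/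
open DirectSum

universe u

/-- For all ideals `I` and `J`, the colon ideals `(J : I)` and `(I : J)` are comaximal. -/
def ColonsComaximal (R : Type u) [CommRing R] : Prop :=
  ∀ I J : Ideal R, ∃ c d : R, c + d = 1 ∧ (∀ x ∈ I, c * x ∈ J) ∧ (∀ x ∈ J, d * x ∈ I)

section

variable {R : Type u} [CommRing R]

theorem IsCFRing.colonsComaximal (hR : IsCFRing R) : ColonsComaximal R := by
  intro I J
  obtain ⟨m, K, hK, -, ⟨e⟩⟩ := hR 2 ![I, J]
  have key : ∀ (i : Fin 2) (x : R), x ∈ ![I, J] i ↔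
      x • (DirectSum.lof R (Fin 2) (fun i => R ⧸ ![I, J] i) i (Ideal.Quotient.mk _ 1)) = 0 := by
    intro i x
    rw [← map_smul, DirectSum.lof_eq_of, map_eq_zero_iff _ (DirectSum.of_injective i),
      ← Ideal.Quotient.eq_zero_iff_mem, Algebra.smul_def]
    simp
  rcases m with _ | m
  · have h0 : ∀ z : (⨁ i, R ⧸ ![I, J] i), z = 0 := fun z => e.injective (Subsingleton.elim _ _)
    have hI : ∀ x, x ∈ I := fun x => (key 0 x).2 (h0 _)
    have hJ : ∀ x, x ∈ J := fun x => (key 1 x).2 (h0 _)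
    exact ⟨1, 0, by simp, fun x _ => hJ _, fun x _ => hI _⟩
  · have hann : ∀ y ∈ K 0, ∀ i, y ∈ ![I, J] i := by
      intro y hy i
      rw [key]
      apply e.injective
      rw [map_smul, map_zero]
      ext j
      rw [DirectSum.smul_apply, DirectSum.zero_apply]
      obtain ⟨z, hz⟩ := Ideal.Quotient.mk_surjective
        ((e (DirectSum.lof R (Fin 2) (fun i => R ⧸ ![I, J] i) i (Ideal.Quotient.mk _ 1))) j)
      rw [← hz, Algebra.smul_def, Ideal.Quotient.algebraMap_eq, ← map_mul,
        Ideal.Quotient.eq_zero_iff_mem]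
      exact Ideal.mul_mem_right _ _ (hK 0 j (Fin.zero_le j) hy)
    set p : (⨁ i, R ⧸ ![I, J] i) →ₗ[R] R ⧸ K 0 :=
      DirectSum.component R (Fin (m + 1)) (fun j => R ⧸ K j) 0 ∘ₗ e.toLinearMap with hp
    set w := e.symm (DirectSum.lof R (Fin (m + 1)) (fun j => R ⧸ K j) 0 (Ideal.Quotient.mk _ 1))
      with hw
    have hpw : p w = Ideal.Quotient.mk _ 1 := by
      simp [hp, hw]
    have hsum : w = ∑ i, DirectSum.lof R (Fin 2) (fun i => R ⧸ ![I, J] i) i (w i) := by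
      conv_lhs => rw [← DirectSum.sum_univ_of w]
      rfl
    choose t ht using fun i => Ideal.Quotient.mk_surjective (w i)
    choose q hq using fun i => Ideal.Quotient.mk_surjective
      (p (DirectSum.lof R (Fin 2) (fun i => R ⧸ ![I, J] i) i (Ideal.Quotient.mk _ 1)))
    have hx : ∀ i, ∀ x ∈ ![I, J] i, q i * x ∈ K 0 := by
      intro i x hx
      rw [key] at hx
      have := congrArg p hx
      rw [map_smul, ← hq, map_zero, Algebra.smul_def, Ideal.Quotient.algebraMap_eq, ← map_mul,
        Ideal.Quotient.eq_zero_iff_mem] at this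
      rwa [mul_comm]
    have h1 : 1 - (t 0 * q 0 + t 1 * q 1) ∈ K 0 := by
      rw [← Ideal.Quotient.mk_eq_mk_iff_sub_mem, ← hpw, hsum, Fin.sum_univ_two, map_add]
      have : ∀ i, p (DirectSum.lof R (Fin 2) (fun i => R ⧸ ![I, J] i) i (w i))
          = Ideal.Quotient.mk _ (t i * q i) := by
        intro i
        have h2 : w i = t i • (Ideal.Quotient.mk (![I, J] i) 1) := by
          rw [← ht, Algebra.smul_def]; simp
        rw [h2, map_smul, map_smul, ← hq, Algebra.smul_def, Ideal.Quotient.algebraMap_eq, map_mul]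
      rw [this, this, map_add]
    refine ⟨t 0 * q 0 + (1 - (t 0 * q 0 + t 1 * q 1)), t 1 * q 1, by ring, ?_, ?_⟩
    · intro x hxI
      refine hann (_) ?_ 1
      rw [add_mul, mul_assoc]
      exact add_mem (Ideal.mul_mem_left _ _ (hx 0 x hxI)) (Ideal.mul_mem_right _ _ h1)
    · intro x hxJ
      refine hann (_) ?_ 0
      rw [mul_assoc]
      exact Ideal.mul_mem_left _ _ (hx 1 x hxJ)

theorem ColonsComaximal.quotient (hR : ColonsComaximal R) (A : Ideal R) :
    ColonsComaximal (R ⧸ A) := by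
  intro I J
  obtain ⟨c, d, hcd, hc, hd⟩ := hR (I.comap (Ideal.Quotient.mk A)) (J.comap (Ideal.Quotient.mk A))
  refine ⟨Ideal.Quotient.mk A c, Ideal.Quotient.mk A d, by rw [← map_add, hcd, map_one], ?_, ?_⟩
  · intro x hx
    obtain ⟨x, rfl⟩ := Ideal.Quotient.mk_surjective x
    simpa using hc x hx
  · intro x hx
    obtain ⟨x, rfl⟩ := Ideal.Quotient.mk_surjective x
    simpa using hd x hx

/-- A family of primes that is discrete in a strong sense can be separated by ring elements
along any subset of the index type. -/
theorem ColonsComaximal.exists_separating (hR : ColonsComaximal R) {ι : Type*} {y : ι → R}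
    {P : ι → Ideal R} (hP : ∀ i, (P i).IsPrime) (hy : ∀ i, y i ∉ P i)
    (hyP : ∀ i j, i ≠ j → y i ∈ P j) (S : Set ι) :
    ∃ x : R, (∀ i ∈ S, x ∉ P i) ∧ ∀ i ∉ S, x ∈ P i := by
  obtain ⟨c, d, hcd, hc, hd⟩ := hR (⨅ i ∈ S, P i) (⨅ i ∈ Sᶜ, P i)
  have hcS : ∀ i ∉ S, c ∈ P i := by
    intro i hi
    have h := hc (y i) (by
      simp only [Ideal.mem_iInf]
      exact fun j hj => hyP i j (by rintro rfl; exact hi hj))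
    simp only [Ideal.mem_iInf] at h
    exact ((hP i).mem_or_mem (h i hi)).resolve_right (hy i)
  have hdS : ∀ i ∈ S, d ∈ P i := by
    intro i hi
    have h := hd (y i) (by
      simp only [Ideal.mem_iInf]
      exact fun j hj => hyP i j (by rintro rfl; exact hj hi))
    simp only [Ideal.mem_iInf] at h
    exact ((hP i).mem_or_mem (h i hi)).resolve_right (hy i)
  refine ⟨c, fun i hi hci => (hP i).one_notMem ?_, hcS⟩
  rw [← hcd]
  exact add_mem hci (hdS i hi)

theorem ColonsComaximal.not_discrete (hR : ColonsComaximal R) {y : ℕ → R}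
    {P : ℕ → Ideal R} (hP : ∀ i, (P i).IsPrime) (hy : ∀ i, y i ∉ P i)
    (hyP : ∀ i j, i ≠ j → y i ∈ P j) : False := by
  let Q : ℕ → ℕ → Ideal R := fun n m => P (Nat.pair n m)
  have hQ : ∀ n m, (Q n m).IsPrime := fun n m => hP _
  have sep : ∀ S : Set (ℕ × ℕ), ∃ x : R, (∀ n m, (n, m) ∈ S → x ∉ Q n m) ∧
      ∀ n m, (n, m) ∉ S → x ∈ Q n m := by
    intro S
    obtain ⟨x, h1, h2⟩ := hR.exists_separating hP hy hyP {i | Nat.unpair i ∈ S}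
    exact ⟨x, fun n m h => h1 _ (by simpa using h), fun n m h => h2 _ (by simpa using h)⟩
  let I : Ideal R :=
    { carrier := {x | ∃ N, ∀ n ≥ N, ∀ m, x ∈ Q n m}
      zero_mem' := ⟨0, fun _ _ _ => zero_mem _⟩
      add_mem' := by
        rintro x z ⟨N, hN⟩ ⟨N', hN'⟩
        exact ⟨max N N', fun n hn m => add_mem (hN n (le_trans (le_max_left _ _) hn) m)
          (hN' n (le_trans (le_max_right _ _) hn) m)⟩
      smul_mem' := by
        rintro r x ⟨N, hN⟩
        exact ⟨N, fun n hn m => Ideal.mul_mem_left _ _ (hN n hn m)⟩ }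
  let J : Ideal R :=
    { carrier := {x | ∀ n, ∃ N, ∀ m ≥ N, x ∈ Q n m}
      zero_mem' := fun _ => ⟨0, fun _ _ => zero_mem _⟩
      add_mem' := by
        intro x z hx hz n
        obtain ⟨N, hN⟩ := hx n
        obtain ⟨N', hN'⟩ := hz n
        exact ⟨max N N', fun m hm => add_mem (hN m (le_trans (le_max_left _ _) hm))
          (hN' m (le_trans (le_max_right _ _) hm))⟩
      smul_mem' := by
        intro r x hx n
        obtain ⟨N, hN⟩ := hx n
        exact ⟨N, fun m hm => Ideal.mul_mem_left _ _ (hN m hm)⟩ }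
  obtain ⟨c, d, hcd, hc, hd⟩ := hR I J
  have hcol : ∀ n, ∃ N, ∀ m ≥ N, c ∈ Q n m := by
    intro n
    obtain ⟨x, hx, hx'⟩ := sep {i | i.1 = n}
    obtain ⟨N, hN⟩ := hc x ⟨n + 1, fun k hk m => hx' k m (by simp; omega)⟩ n
    exact ⟨N, fun m hm => ((hQ n m).mem_or_mem (hN m hm)).resolve_right (hx n m rfl)⟩
  choose F hF using hcol
  obtain ⟨x, hx, hx'⟩ := sep {i | i.2 = F i.1}
  obtain ⟨N, hN⟩ := hd x (fun n => ⟨F n + 1, fun m hm => hx' n m (by simp; omega)⟩)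
  have h1 := ((hQ N (F N)).mem_or_mem (hN N le_rfl (F N))).resolve_right (hx N _ rfl)
  exact (hQ N (F N)).one_notMem (hcd ▸ add_mem (hF N _ le_rfl) h1)

theorem ColonsComaximal.exists_unit_of_pure (hR : ColonsComaximal R) {K : Ideal R}
    (hK : ∀ x ∈ K, ∃ k ∈ K, k * x = x) : ∃ k ∈ K, ∀ x ∈ K, k * x = x := by
  by_contra! hcon
  have step : ∀ k : K, ∃ k' : K, (k' * k : R) = k ∧ (k' : R) ∉ (Ideal.span {(k : R)}).radical := by
    rintro ⟨k, hk⟩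
    obtain ⟨l, hl, hlk⟩ := hK k hk
    obtain ⟨x, hx, hxl⟩ : ∃ x ∈ K, x ∉ (Ideal.span {k}).radical := by
      by_contra! hrad
      obtain ⟨z, hz, hzl⟩ := hcon l hl
      apply hzl
      obtain ⟨w, hw, hwz⟩ := hK z hz
      obtain ⟨n, hn⟩ := hrad w hw
      obtain ⟨r, hr⟩ := Ideal.mem_span_singleton'.1 hn
      have hwn : w ^ n * z = z := by
        clear hn hr
        induction n with
        | zero => simp
        | succ n ih => rw [pow_succ, mul_assoc, hwz, ih]
      rw [← hwn, ← hr]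
      linear_combination r * z * hlk
    obtain ⟨l', hl', hlx⟩ := hK x hx
    refine ⟨⟨l + l' - l * l', sub_mem (add_mem hl hl') (Ideal.mul_mem_left _ _ hl')⟩, ?_, ?_⟩
    · change (l + l' - l * l') * k = k
      linear_combination hlk - l' * hlk
    · intro h
      apply hxl
      have : (l + l' - l * l') * x = x := by linear_combination hlx - l * hlx
      rw [← this]
      exact Ideal.mul_mem_right _ _ h
  choose f hf hf' using step
  let k : ℕ → K := fun n => f^[n] 0
  have hk : ∀ n, k (n + 1) = f (k n) := fun n => Function.iterate_succ_apply' f n 0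
  have hmul : ∀ i j, i < j → (k j * k i : R) = k i := by
    intro i j hij
    induction j, hij using Nat.le_induction with
    | base => rw [hk]; exact hf _
    | succ j hj ih => 
      rw [← ih, hk, ← mul_assoc, hf]
  have hprime : ∀ n, ∃ P : Ideal R, P.IsPrime ∧ (k n : R) ∈ P ∧ (k (n + 1) : R) ∉ P := by
    intro n
    have := hf' (k n)
    rw [← hk, Ideal.radical_eq_sInf, Submodule.mem_sInf] at this
    push Not at this
    obtain ⟨P, ⟨hle, hP⟩, hn⟩ := this
    exact ⟨P, hP, hle (Ideal.mem_span_singleton_self _), hn⟩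
  choose P hP hkP hkP' using hprime
  have low : ∀ i n, i ≤ n → (k i : R) ∈ P n := by
    intro i n hin
    rcases hin.eq_or_lt with rfl | h
    · exact hkP _
    · rw [← hmul i n h]
      exact Ideal.mul_mem_right _ _ (hkP n)
  have high : ∀ j n, n + 2 ≤ j → 1 - (k j : R) ∈ P n := by
    intro j n hj
    have h : (1 - (k j : R)) * k (n + 1) ∈ P n := by
      have h0 : (1 - (k j : R)) * k (n + 1) = 0 := by
        linear_combination - hmul (n + 1) j (by omega)
      rw [h0]; exact zero_mem _
    exact ((hP n).mem_or_mem h).resolve_right (hkP' n)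
  refine hR.not_discrete (y := fun n => (k (2 * n + 1) - k (2 * n) : R)) (P := fun n => P (2 * n))
    (fun n => hP _) (fun n h => ?_) (fun i j hij => ?_)
  · exact hkP' (2 * n) ((Submodule.sub_mem_iff_left _ (hkP _)).1 h)
  · rcases lt_or_gt_of_ne hij with h | h
    · exact sub_mem (low _ _ (by omega)) (low _ _ (by omega))
    · have := sub_mem (high (2 * i) (2 * j) (by omega)) (high (2 * i + 1) (2 * j) (by omega))
      simpa using this

theorem ColonsComaximal.exists_unit_of_relatively_pure (hR : ColonsComaximal R) {A K : Ideal R}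
    (hAK : A ≤ K) (hK : ∀ x ∈ K, ∃ k ∈ K, x - k * x ∈ A) :
    ∃ k ∈ K, ∀ x ∈ K, x - k * x ∈ A := by
  have hmem : ∀ x, Ideal.Quotient.mk A x ∈ K.map (Ideal.Quotient.mk A) ↔ x ∈ K := by
    intro x
    rw [← Ideal.mem_comap, Ideal.comap_map_of_surjective _ Ideal.Quotient.mk_surjective,
      ← RingHom.ker_eq_comap_bot, Ideal.mk_ker, sup_eq_left.2 hAK]
  obtain ⟨k, hk, h⟩ := (hR.quotient A).exists_unit_of_pure (K := K.map (Ideal.Quotient.mk A)) (by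
    intro x hx
    obtain ⟨x, rfl⟩ := Ideal.Quotient.mk_surjective x
    obtain ⟨k, hk, h⟩ := hK x ((hmem x).1 hx)
    refine ⟨Ideal.Quotient.mk A k, (hmem k).2 hk, ?_⟩
    rw [← map_mul, eq_comm]
    exact (Ideal.Quotient.mk_eq_mk_iff_sub_mem _ _).2 h)
  obtain ⟨k, rfl⟩ := Ideal.Quotient.mk_surjective k
  refine ⟨k, (hmem k).1 hk, fun x hx => ?_⟩
  rw [← Ideal.Quotient.mk_eq_mk_iff_sub_mem, map_mul, h _ ((hmem x).2 hx)]

theorem ColonsComaximal.exists_mul_eq_or (hR : ColonsComaximal R) (N : Ideal R) [hN : N.IsPrime]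
    (x y : R) : (∃ s ∉ N, ∃ r, s * x = r * y) ∨ ∃ s ∉ N, ∃ r, s * y = r * x := by
  obtain ⟨c, d, hcd, hc, hd⟩ := hR (Ideal.span {x}) (Ideal.span {y})
  obtain ⟨r, hr⟩ := Ideal.mem_span_singleton'.1 (hc x (Ideal.mem_span_singleton_self x))
  obtain ⟨r', hr'⟩ := Ideal.mem_span_singleton'.1 (hd y (Ideal.mem_span_singleton_self y))
  by_cases h : c ∈ N
  · refine Or.inr ⟨d, fun hdN => hN.one_notMem (hcd ▸ add_mem h hdN), r', hr'.symm⟩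
  · exact Or.inl ⟨c, h, r, hr.symm⟩

theorem ColonsComaximal.prime_le_or_le (hR : ColonsComaximal R) (N : Ideal R) [N.IsPrime]
    {p q : Ideal R} [hp : p.IsPrime] [hq : q.IsPrime] (hpN : p ≤ N) (hqN : q ≤ N) :
    p ≤ q ∨ q ≤ p := by
  by_contra! h
  obtain ⟨x, hxp, hxq⟩ := SetLike.not_le_iff_exists.1 h.1
  obtain ⟨y, hyq, hyp⟩ := SetLike.not_le_iff_exists.1 h.2
  rcases hR.exists_mul_eq_or N x y with ⟨s, hs, r, e⟩ | ⟨s, hs, r, e⟩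
  · have : s * x ∈ q := e ▸ Ideal.mul_mem_left _ _ hyq
    exact (hq.mem_or_mem this).elim (fun h => hs (hqN h)) hxq
  · have : s * y ∈ p := e ▸ Ideal.mul_mem_left _ _ hxp
    exact (hp.mem_or_mem this).elim (fun h => hs (hpN h)) hyp

theorem ColonsComaximal.exists_mul_pow_mem (hR : ColonsComaximal R) {I p : Ideal R}
    (hp : p ∈ I.minimalPrimes) (N : Ideal R) [N.IsPrime] (hpN : p ≤ N) {x : R} (hx : x ∈ p) :
    ∃ u ∉ N, ∃ n : ℕ, u * x ^ n ∈ I := by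
  by_contra! hcon
  have := hp.1.1
  have hdisj : Disjoint (I : Set R) (N.primeCompl ⊔ Submonoid.powers x : Submonoid R) := by
    rw [Set.disjoint_left]
    intro z hzI hz
    obtain ⟨u, hu, w, ⟨n, rfl⟩, rfl⟩ := Submonoid.mem_sup.1 hz
    exact hcon u hu n hzI
  obtain ⟨q, hq, hIq, hqd⟩ := Ideal.exists_le_prime_disjoint I _ hdisj
  rw [Set.disjoint_left] at hqd
  have hqN : q ≤ N := by
    intro z hz
    by_contra h
    exact hqd hz (Submonoid.mem_sup_left (show z ∈ N.primeCompl from h))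
  have hpq : p ≤ q := (hR.prime_le_or_le N hpN hqN).elim id (fun h => hp.2 ⟨hq, hIq⟩ h)
  exact hqd (hpq hx) (Submonoid.mem_sup_right (Submonoid.mem_powers x))

/-- The zero locus of an element is irreducible near each of its points. -/
theorem ColonsComaximal.exists_prime_le_of_mem (hR : ColonsComaximal R) (M : Ideal R)
    [hM : M.IsPrime] {a : R} (ha : a ∈ M) :
    ∃ p : Ideal R, p.IsPrime ∧ a ∈ p ∧ p ≤ M ∧ ∃ s ∉ M, ∀ P : Ideal R, P.IsPrime → a ∈ P →
      s ∉ P → p ≤ P := by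
  obtain ⟨p, hp, hpM⟩ := Ideal.exists_minimalPrimes_le
    ((Ideal.span_singleton_le_iff_mem M).2 ha)
  have hpp := hp.1.1
  have hle : (Ideal.span {a}).radical ≤ p := hpp.radical_le_iff.2 hp.1.2
  obtain ⟨k, hk, hkp⟩ := hR.exists_unit_of_relatively_pure hle (by
    intro x hx
    have htop : (Ideal.span {a}).radical.colon {x} ⊔ p = ⊤ := by
      by_contra h
      obtain ⟨N, hN, hle'⟩ := Ideal.exists_le_maximal _ h
      have := hN.isPrime
      obtain ⟨u, hu, n, hn⟩ := hR.exists_mul_pow_mem hp N (le_sup_right.trans hle') hx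
      apply hu
      apply hle'
      apply Submodule.mem_sup_left
      rw [Submodule.mem_colon_singleton, smul_eq_mul]
      refine ⟨n + 1, ?_⟩
      have : (u * x) ^ (n + 1) = u ^ n * x * (u * x ^ n) := by ring
      rw [this]
      exact Ideal.mul_mem_left _ _ hn
    obtain ⟨t, ht, k, hk, htk⟩ := Submodule.mem_sup.1 (htop ▸ Submodule.mem_top (x := (1 : R)))
    refine ⟨k, hk, ?_⟩
    rw [Submodule.mem_colon_singleton, smul_eq_mul] at ht
    have : x - k * x = t * x := by linear_combination (-x) * htk
    rwa [this])
  refine ⟨p, hpp, hp.1.2 (Ideal.mem_span_singleton_self a), hpM, 1 - k, fun h => ?_, ?_⟩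
  · exact hM.one_notMem (by simpa using add_mem h (hpM hk))
  · intro P hP haP hs x hx
    have h1 := hP.radical_le_iff.2 ((Ideal.span_singleton_le_iff_mem P).2 haP) (hkp x hx)
    have h2 : x - k * x = (1 - k) * x := by ring
    rw [h2] at h1
    exact (hP.mem_or_mem h1).resolve_left hs

/-- The elements that become multiples of `x` in the localization at `N`. -/
def multiplesAt (N : Ideal R) [N.IsPrime] (x : R) : Ideal R where
  carrier := {y | ∃ u ∉ N, ∃ r, u * y = r * x}
  zero_mem' := ⟨1, Ideal.IsPrime.one_notMem ‹_›, 0, by simp⟩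
  add_mem' := by
    rintro y z ⟨u, hu, r, h⟩ ⟨v, hv, t, h'⟩
    exact ⟨u * v, Ideal.IsPrime.mul_notMem ‹_› hu hv, v * r + u * t,
      by linear_combination v * h + u * h'⟩
  smul_mem' := by
    rintro c y ⟨u, hu, r, h⟩
    exact ⟨u, hu, c * r, by rw [smul_eq_mul]; linear_combination c * h⟩

theorem ColonsComaximal.exists_mul_eq_of_mem_of_notMem (hR : ColonsComaximal R) {p M : Ideal R}
    [hp : p.IsPrime] [M.IsPrime] (hpM : p ≤ M) {x g : R} (hx : x ∈ p) (hg : g ∉ p) :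
    ∃ v ∉ M, ∃ y, v * x = g * y := by
  rcases hR.exists_mul_eq_or M x g with ⟨s, hs, r, e⟩ | ⟨s, hs, r, e⟩
  · exact ⟨s, hs, r, by rw [e, mul_comm]⟩
  · have : s * g ∈ p := e ▸ Ideal.mul_mem_left _ _ hx
    exact ((hp.mem_or_mem this).elim (fun h => hs (hpM h)) hg).elim

theorem ColonsComaximal.exists_mul_eq_zero_of_multiplesAt (hR : ColonsComaximal R)
    {p M P : Ideal R}
    [hp : p.IsPrime] [hM : M.IsPrime] [hP : P.IsPrime] (hpM : p ≤ M) (hpP : p ≤ P)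
    {x s c : R} (hx : x ∈ p) (hs : s ∈ M) (hsP : s ∉ P) (hcP : c ∉ M ∨ c ∉ P)
    (hc : ∀ y ∈ multiplesAt P x, c * y ∈ multiplesAt M x) : ∃ u ∉ M, u * x = 0 := by
  rcases hcP with hcM | hcP
  · obtain ⟨v, hv, y, e⟩ := hR.exists_mul_eq_of_mem_of_notMem hpM hx (fun h => hsP (hpP h))
    obtain ⟨u, hu, r, e'⟩ := hc y ⟨s, hsP, v, e.symm⟩
    refine ⟨u * c * v - s * r, fun h => ?_, by linear_combination u * c * e + s * e'⟩
    exact hM.mul_notMem (hM.mul_notMem hu hcM) hv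
      ((Submodule.sub_mem_iff_left _ (Ideal.mul_mem_right _ _ hs)).1 h)
  · have hg : s * c ∉ P := hP.mul_notMem hsP hcP
    obtain ⟨v, hv, y, e⟩ := hR.exists_mul_eq_of_mem_of_notMem hpM hx (fun h => hg (hpP h))
    obtain ⟨u, hu, r, e'⟩ := hc y ⟨s * c, hg, v, e.symm⟩
    refine ⟨u * v - s * r, fun h => ?_, by linear_combination u * e + s * e'⟩
    exact hM.mul_notMem hu hv ((Submodule.sub_mem_iff_left _ (Ideal.mul_mem_right _ _ hs)).1 h)

/-- An element of a prime contained in two incomparable primes `M` and `P` vanishes at `M`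
or at `P`. -/
theorem ColonsComaximal.exists_mul_eq_zero_or (hR : ColonsComaximal R) {p M P : Ideal R}
    [hp : p.IsPrime] [hM : M.IsPrime] [hP : P.IsPrime] (hpM : p ≤ M) (hpP : p ≤ P)
    (hMP : ¬ M ≤ P) (hPM : ¬ P ≤ M) {x : R} (hx : x ∈ p) :
    (∃ u ∉ M, u * x = 0) ∨ ∃ u ∉ P, u * x = 0 := by
  obtain ⟨s, hsM, hsP⟩ := SetLike.not_le_iff_exists.1 hMP
  obtain ⟨t, htP, htM⟩ := SetLike.not_le_iff_exists.1 hPM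
  obtain ⟨d, c, hcd, hd, hc⟩ := hR (multiplesAt M x) (multiplesAt P x)
  by_cases h : c ∉ M ∨ c ∉ P
  · exact Or.inl (hR.exists_mul_eq_zero_of_multiplesAt hpM hpP hx hsM hsP h hc)
  · push Not at h
    refine Or.inr (hR.exists_mul_eq_zero_of_multiplesAt hpP hpM hx htP htM (Or.inl ?_) hd)
    exact fun hdP => hP.one_notMem (hcd ▸ add_mem hdP h.2)

/-- If `b` generates the annihilator of `a` at `M` and does not vanish at `M`, then `a`
generates the annihilator of `b` at `M`. -/
theorem ColonsComaximal.exists_mul_eq_of_annihilator (hR : ColonsComaximal R) {M : Ideal R}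
    [hM : M.IsPrime] {a b : R}
    (hb : ∀ x, a * x = 0 → ∃ s ∉ M, ∃ r, s * x = r * b) (hb0 : ∀ u ∉ M, u * b ≠ 0)
    {x : R} (hx : b * x = 0) : ∃ s ∉ M, ∃ r, s * x = r * a := by
  by_contra! hcon
  obtain ⟨s, hs, c, e⟩ := (hR.exists_mul_eq_or M x a).resolve_left
    (fun ⟨s, hs, r, h⟩ => hcon s hs r h)
  have hc : c ∈ M := by
    by_contra hc
    exact hcon c hc s e.symm
  rcases hR.exists_mul_eq_or M b c with ⟨v, hv, t, e'⟩ | ⟨v, hv, t, e'⟩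
  · obtain ⟨w, hw, r, e''⟩ := hb (s * t) (by linear_combination t * e + v * hx - x * e')
    refine hb0 (w * s * v - c * r) (fun h => ?_) ?_
    · exact hM.mul_notMem (hM.mul_notMem hw hs) hv
        ((Submodule.sub_mem_iff_left _ (Ideal.mul_mem_right _ _ hc)).1 h)
    · linear_combination w * s * e' + c * e''
  · obtain ⟨w, hw, r, e''⟩ := hb (s * v) (by linear_combination v * e + t * hx + x * e')
    have hbM : b ∉ M := fun h => hM.mul_notMem hw (hM.mul_notMem hs hv)
      (e'' ▸ Ideal.mul_mem_left _ _ h)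
    exact hcon b hbM 0 (by rw [hx, zero_mul])

/-- The annihilator of `a` is generated by one element in the localization at `M`. -/
def AnnPrincipalAt (M : Ideal R) (a : R) : Prop :=
  ∃ b, a * b = 0 ∧ ∀ x, a * x = 0 → ∃ s ∉ M, ∃ r, s * x = r * b

/-- The annihilator of `a` is generated by one element on a basic open neighbourhood of `M`. -/
def AnnPrincipalNear (M : Ideal R) (a : R) : Prop :=
  ∃ b, a * b = 0 ∧ ∃ s ∉ M, ∀ x, a * x = 0 → ∃ (n : ℕ) (r : R), s ^ n * x = r * b

theorem ColonsComaximal.annPrincipalNear (hR : ColonsComaximal R) {M : Ideal R}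
    [hM : M.IsMaximal] {a : R} (h : AnnPrincipalAt M a) : AnnPrincipalNear M a := by
  obtain ⟨b, hab, hb⟩ := h
  have hMp := hM.isPrime
  by_cases ha0 : ∃ u ∉ M, u * a = 0
  · obtain ⟨u, hu, hua⟩ := ha0
    exact ⟨u, by rw [mul_comm, hua], u, hu, fun x _ => ⟨1, x, by ring⟩⟩
  have haM : a ∈ M ∨ a ∉ M := em _
  rcases haM with haM | haM
  swap
  · exact ⟨0, by simp, a, haM, fun x hx => ⟨1, 0, by rw [pow_one, hx, zero_mul]⟩⟩
  have hbM : b ∈ M := by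
    by_contra hbM
    exact ha0 ⟨b, hbM, by rw [mul_comm, hab]⟩
  obtain ⟨p, hp, hap, hpM, s, hs, hsP⟩ := hR.exists_prime_le_of_mem M haM
  obtain ⟨p', hp', hbp', hpM', s', hs', hsP'⟩ := hR.exists_prime_le_of_mem M hbM
  refine ⟨b, hab, s * s', hMp.mul_notMem hs hs', fun x hx => ?_⟩
  by_contra! hcon
  have hx' : s * s' ∉ ((Ideal.span {b}).colon {x}).radical := by
    rintro ⟨n, hn⟩
    rw [Submodule.mem_colon_singleton, smul_eq_mul, Ideal.mem_span_singleton'] at hn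
    obtain ⟨r, hr⟩ := hn
    exact hcon n r hr.symm
  rw [Ideal.radical_eq_sInf, Submodule.mem_sInf] at hx'
  push Not at hx'
  obtain ⟨P, ⟨hleP, hP⟩, hssP⟩ := hx'
  have hxP : ∀ u ∉ P, ∀ r, u * x ≠ r * b := by
    intro u hu r h
    apply hu
    apply hleP
    rw [Submodule.mem_colon_singleton, smul_eq_mul, h]
    exact Ideal.mul_mem_left _ _ (Ideal.mem_span_singleton_self b)
  have hPM : ¬ P ≤ M := by
    obtain ⟨v, hv, r, e⟩ := hb x hx
    intro hle
    exact hxP v (fun h => hv (hle h)) r e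
  have hMP : ¬ M ≤ P := fun hle => hPM (hM.eq_of_le hP.ne_top hle).ge
  have hsnP : s ∉ P := fun h => hssP (Ideal.mul_mem_right _ _ h)
  have hsnP' : s' ∉ P := fun h => hssP (Ideal.mul_mem_left _ _ h)
  have haP : a ∈ P := by
    by_contra h
    exact hxP a h 0 (by rw [hx, zero_mul])
  have hpP : p ≤ P := hsP P hP haP hsnP
  obtain ⟨u, hu, hua⟩ := (hR.exists_mul_eq_zero_or hpM hpP hMP hPM hap).resolve_left ha0
  by_cases hb0 : ∃ v ∉ M, v * b = 0
  · obtain ⟨v, hv, hvb⟩ := hb0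
    obtain ⟨w, hw, r, e⟩ := hb u (by rw [mul_comm, hua])
    have : v * w * u ∈ p := by
      have : v * w * u = 0 := by linear_combination v * e + r * hvb
      rw [this]; exact zero_mem _
    exact hu (hpP ((hp.mem_or_mem this).resolve_left
      (fun h => hMp.mul_notMem hv hw (hpM h))))
  · have hbP : b ∈ P := by
      by_contra h
      exact hxP b h x (mul_comm _ _)
    have hpP' : p' ≤ P := hsP' P hP hbP hsnP'
    obtain ⟨u', hu', hub⟩ := (hR.exists_mul_eq_zero_or hpM' hpP' hMP hPM hbp').resolve_left hb0
    push Not at hb0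
    obtain ⟨v, hv, r, e⟩ := hR.exists_mul_eq_of_annihilator hb hb0
      (x := u') (by rw [mul_comm, hub])
    have : v * u' ∈ p := e ▸ Ideal.mul_mem_left _ _ hap
    exact hu' (hpP ((hp.mem_or_mem this).resolve_left (fun h => hv (hpM h))))

/-- A submodule is finitely generated on a basic open neighbourhood of `M`. -/
def FGNear {V : Type*} [AddCommGroup V] [Module R V] (M : Ideal R) (K : Submodule R V) : Prop :=
  ∃ K₀ ≤ K, K₀.FG ∧ ∃ s ∉ M, ∀ x ∈ K, ∃ n : ℕ, s ^ n • x ∈ K₀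

theorem Submodule.fg_of_forall_fgNear {V : Type*} [AddCommGroup V] [Module R V]
    {K : Submodule R V} (h : ∀ M : Ideal R, M.IsMaximal → FGNear M K) : K.FG := by
  let S : Ideal R :=
    { carrier := {s | ∃ K₀ ≤ K, K₀.FG ∧ ∀ x ∈ K, s ∈ (K₀.colon {x}).radical}
      zero_mem' := ⟨⊥, bot_le, Submodule.fg_bot, fun _ _ => zero_mem _⟩
      add_mem' := by
        rintro s t ⟨K₁, hle₁, hfg₁, h₁⟩ ⟨K₂, hle₂, hfg₂, h₂⟩
        refine ⟨K₁ ⊔ K₂, sup_le hle₁ hle₂, hfg₁.sup hfg₂, fun x hx => add_mem ?_ ?_⟩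
        · exact Ideal.radical_mono (Submodule.colon_mono le_sup_left le_rfl) (h₁ x hx)
        · exact Ideal.radical_mono (Submodule.colon_mono le_sup_right le_rfl) (h₂ x hx)
      smul_mem' := by
        rintro r s ⟨K₁, hle₁, hfg₁, h₁⟩
        exact ⟨K₁, hle₁, hfg₁, fun x hx => Ideal.mul_mem_left _ _ (h₁ x hx)⟩ }
  have hS : S = ⊤ := by
    by_contra hS
    obtain ⟨M, hM, hle⟩ := Ideal.exists_le_maximal S hS
    obtain ⟨K₀, hK₀, hfg, s, hs, hsx⟩ := h M hM
    refine hs (hle ⟨K₀, hK₀, hfg, fun x hx => ?_⟩)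
    obtain ⟨n, hn⟩ := hsx x hx
    exact ⟨n, Submodule.mem_colon_singleton.2 hn⟩
  obtain ⟨K₀, hK₀, hfg, h1⟩ : (1 : R) ∈ S := hS ▸ Submodule.mem_top
  have : K = K₀ := by
    refine le_antisymm (fun x hx => ?_) hK₀
    obtain ⟨n, hn⟩ := h1 x hx
    simpa [Submodule.mem_colon_singleton] using hn
  exact this ▸ hfg

theorem ColonsComaximal.exists_dvd_at (hR : ColonsComaximal R) (M : Ideal R) [hM : M.IsPrime]
    {ι : Type*} {T : Finset ι} (hT : T.Nonempty) (f : ι → R) :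
    ∃ k ∈ T, ∃ s ∉ M, ∀ i ∈ T, ∃ r, s * f i = r * f k := by
  induction hT using Finset.Nonempty.cons_induction with
  | singleton j => exact ⟨j, by simp, 1, hM.one_notMem, fun i hi => ⟨1, by simp_all⟩⟩
  | cons j T hj hT ih =>
    obtain ⟨k, hk, s, hs, h⟩ := ih
    simp only [Finset.mem_cons, forall_eq_or_imp]
    rcases hR.exists_mul_eq_or M (f j) (f k) with ⟨t, ht, r, e⟩ | ⟨t, ht, r, e⟩
    · refine ⟨k, Or.inr hk, s * t, hM.mul_notMem hs ht, ⟨s * r, by linear_combination s * e⟩, ?_⟩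
      intro i hi
      obtain ⟨q, hq⟩ := h i hi
      exact ⟨t * q, by linear_combination t * hq⟩
    · refine ⟨j, Or.inl rfl, s * t, hM.mul_notMem hs ht, ⟨s * t, rfl⟩, ?_⟩
      intro i hi
      obtain ⟨q, hq⟩ := h i hi
      exact ⟨q * r, by linear_combination t * hq + q * e⟩

/-- The vectors whose coordinates outside `T` vanish. -/
def supportedOn (R : Type*) [CommRing R] {ι : Type*} (T : Finset ι) : Submodule R (ι → R) where
  carrier := {v | ∀ i ∉ T, v i = 0}
  zero_mem' := fun _ _ => rfl
  add_mem' := fun hv hw i hi => by rw [Pi.add_apply, hv i hi, hw i hi, add_zero]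
  smul_mem' := fun r v hv i hi => by rw [Pi.smul_apply, hv i hi, smul_zero]

variable {ι κ : Type*}

theorem eq_zero_of_mem_supportedOn_empty {v : ι → R} (hv : v ∈ supportedOn R (∅ : Finset ι)) :
    v = 0 := funext fun i => hv i (Finset.notMem_empty i)

variable [DecidableEq ι]

theorem single_mem_supportedOn {T : Finset ι} {l : ι} (hl : l ∈ T) (r : R) :
    Pi.single l r ∈ supportedOn R T := by
  intro i hi
  rw [Pi.single_eq_of_ne (ne_of_mem_of_not_mem hl hi).symm]

theorem eq_sum_of_mem_supportedOn {T : Finset ι} {v : ι → R} (hv : v ∈ supportedOn R T) :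
    v = ∑ j ∈ T, v j • Pi.single j (1 : R) := by
  ext i
  simp only [Finset.sum_apply, Pi.smul_apply, Pi.single_apply, smul_eq_mul, mul_ite, mul_one,
    mul_zero]
  rw [Finset.sum_ite_eq T i]
  split_ifs with h
  · rfl
  · exact hv i h

/-- An entry `a` of the matrix of `φ` (restricted to the columns in `T`) which divides the other
entries at `M`, together with the quotients of the entries in its row and column. -/
structure Pivot (M : Ideal R) (φ : (ι → R) →ₗ[R] (κ → R)) (T : Finset ι) where
  col : ι
  col_mem : col ∈ T
  row : κ
  a : R
  s : R
  s_notMem : s ∉ M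
  μ : (ι → R) →ₗ[R] R
  e : κ → R
  smul_map_single : s • φ (Pi.single col 1) = a • e
  e_row : e row = s
  μ_single : μ (Pi.single col 1) = s
  mul_map_row : ∀ v ∈ supportedOn R T, s * φ v row = μ v * a

theorem ColonsComaximal.nonempty_pivot (hR : ColonsComaximal R) (M : Ideal R) [hM : M.IsPrime]
    [Fintype κ] [Nonempty κ] (φ : (ι → R) →ₗ[R] (κ → R)) {T : Finset ι} (hT : T.Nonempty) :
    Nonempty (Pivot M φ T) := by
  classical
  obtain ⟨⟨l, k⟩, hlk, s, hs, h⟩ := hR.exists_dvd_at M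
    (hT.product (Finset.univ_nonempty (α := κ))) (fun p => φ (Pi.single p.1 1) p.2)
  have hl : l ∈ T := (Finset.mem_product.1 hlk).1
  have h' : ∀ (j : ι) (i : κ), ∃ r, (j ∈ T → s * φ (Pi.single j 1) i = r * φ (Pi.single l 1) k) ∧
      (j = l ∧ i = k → r = s) := by
    intro j i
    by_cases hji : j = l ∧ i = k
    · obtain ⟨rfl, rfl⟩ := hji
      exact ⟨s, fun _ => rfl, fun _ => rfl⟩
    · by_cases hj : j ∈ T
      · obtain ⟨r, hr⟩ := h (j, i) (Finset.mem_product.2 ⟨hj, Finset.mem_univ _⟩)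
        exact ⟨r, fun _ => hr, fun h => (hji h).elim⟩
      · exact ⟨0, fun h => (hj h).elim, fun h => (hji h).elim⟩
  choose r hr hrs using h'
  refine ⟨⟨l, hl, k, φ (Pi.single l 1) k, s, hs, ∑ j ∈ T, r j k • LinearMap.proj j, r l, ?_,
    hrs l k ⟨rfl, rfl⟩, ?_, ?_⟩⟩
  · ext i
    rw [Pi.smul_apply, Pi.smul_apply, smul_eq_mul, smul_eq_mul, hr l i hl, mul_comm]
  · simp only [LinearMap.sum_apply, LinearMap.smul_apply, LinearMap.proj_apply, Pi.single_apply,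
      smul_eq_mul, mul_ite, mul_one, mul_zero]
    rw [Finset.sum_ite_eq' T l, if_pos hl, hrs l k ⟨rfl, rfl⟩]
  · intro v hv
    conv_lhs => rw [eq_sum_of_mem_supportedOn hv]
    simp only [map_sum, map_smul, Finset.sum_apply, Pi.smul_apply, smul_eq_mul,
      LinearMap.sum_apply, LinearMap.smul_apply, LinearMap.proj_apply, Finset.mul_sum,
      Finset.sum_mul]
    refine Finset.sum_congr rfl fun j hj => ?_
    linear_combination v j * hr j k hj

namespace Pivot

variable {M : Ideal R} {φ : (ι → R) →ₗ[R] (κ → R)} {T : Finset ι}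

/-- Clearing the row of the pivot by column operations, up to powers of `s`. -/
def clear (π : Pivot M φ T) : (ι → R) →ₗ[R] (ι → R) :=
  π.s • (π.s • LinearMap.id - π.μ.smulRight (Pi.single π.col 1))

theorem clear_apply (π : Pivot M φ T) (v : ι → R) :
    π.clear v = π.s • (π.s • v - π.μ v • Pi.single π.col 1) := by
  simp [clear]

theorem clear_mem (π : Pivot M φ T) {v : ι → R} (hv : v ∈ supportedOn R (T.erase π.col)) :
    π.clear v ∈ supportedOn R T := by
  rw [clear_apply]
  refine Submodule.smul_mem _ _ (sub_mem (Submodule.smul_mem _ _ fun i hi => hv i ?_)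
    (Submodule.smul_mem _ _ (single_mem_supportedOn π.col_mem 1)))
  exact fun h => hi (Finset.mem_of_mem_erase h)

theorem map_clear_row (π : Pivot M φ T) {v : ι → R} (hv : v ∈ supportedOn R T) :
    φ (π.clear v) π.row = 0 := by
  have h1 := π.mul_map_row v hv
  have h2 := congrFun π.smul_map_single π.row
  simp only [Pi.smul_apply, smul_eq_mul, π.e_row] at h2
  simp only [clear_apply, map_smul, map_sub, Pi.smul_apply, Pi.sub_apply, smul_eq_mul]
  linear_combination π.s * h1 - π.μ v * h2

theorem exists_clear_eq (π : Pivot M φ T) {v : ι → R} (hv : v ∈ supportedOn R T) :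
    ∃ u ∈ supportedOn R (T.erase π.col),
      π.clear u = π.s ^ 2 • (π.s • v - π.μ v • Pi.single π.col 1) := by
  set w := π.s • v - π.μ v • Pi.single π.col (1 : R) with hw
  have hμw : π.μ w = 0 := by
    simp [hw, π.μ_single, mul_comm]
  have hwT : w ∈ supportedOn R T := sub_mem (Submodule.smul_mem _ _ hv)
    (Submodule.smul_mem _ _ (single_mem_supportedOn π.col_mem 1))
  refine ⟨w - w π.col • Pi.single π.col 1, ?_, ?_⟩
  · intro i hi
    by_cases hil : i = π.col
    · subst hil
      simp
    · have : i ∉ T := fun h => hi (Finset.mem_erase.2 ⟨hil, h⟩)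
      simp [hwT i this, hil]
  · rw [clear_apply, map_sub, hμw, map_smul, π.μ_single]
    module

theorem map_smul_sub (π : Pivot M φ T) {v : ι → R} (h : π.μ v * π.a = 0) :
    π.s • φ (π.s • v - π.μ v • Pi.single π.col 1) = π.s ^ 2 • φ v := by
  have h2 := π.smul_map_single
  rw [map_sub, map_smul, map_smul, smul_sub, smul_comm π.s (π.μ v), h2, smul_smul (π.μ v), h,
    zero_smul, sub_zero, smul_smul, sq]

theorem fgNear_ker [hM : M.IsPrime] (π : Pivot M φ T) (ha : AnnPrincipalNear M π.a)
    (h : FGNear M (LinearMap.ker (φ ∘ₗ π.clear) ⊓ supportedOn R (T.erase π.col))) :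
    FGNear M (LinearMap.ker φ ⊓ supportedOn R T) := by
  obtain ⟨K₀, hK₀, hfg, t, ht, htK⟩ := h
  obtain ⟨b, hab, z, hz, hzb⟩ := ha
  refine ⟨K₀.map π.clear ⊔ Submodule.span R {(π.s * b) • Pi.single π.col 1},
    sup_le ?_ ?_, (hfg.map _).sup (Submodule.fg_span_singleton _), π.s * t * z,
    hM.mul_notMem (hM.mul_notMem π.s_notMem ht) hz, ?_⟩
  · rintro _ ⟨u, hu, rfl⟩
    exact ⟨(hK₀ hu).1, π.clear_mem (hK₀ hu).2⟩
  · rw [Submodule.span_singleton_le_iff_mem]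
    refine ⟨?_, Submodule.smul_mem _ _ (single_mem_supportedOn π.col_mem 1)⟩
    rw [SetLike.mem_coe, LinearMap.mem_ker, map_smul, mul_comm, mul_smul, π.smul_map_single,
      smul_smul, mul_comm, hab, zero_smul]
  · rintro v ⟨hv, hvT⟩
    rw [SetLike.mem_coe, LinearMap.mem_ker] at hv
    have hμ : π.μ v * π.a = 0 := by
      rw [← π.mul_map_row v hvT, hv, Pi.zero_apply, mul_zero]
    obtain ⟨u, hu, huv⟩ := π.exists_clear_eq hvT
    have hφu : φ (π.clear u) = 0 := by
      rw [huv, map_smul, sq, mul_smul, π.map_smul_sub hμ, hv, smul_zero, smul_zero]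
    obtain ⟨n, hn⟩ := htK u ⟨hφu, hu⟩
    obtain ⟨m, r, hr⟩ := hzb (π.μ v) (by rw [mul_comm, hμ])
    refine ⟨n + m + 3, ?_⟩
    have key : (π.s * t * z) ^ (n + m + 3) • v =
        (π.s ^ (n + m) * t ^ (m + 3) * z ^ (n + m + 3)) • π.clear (t ^ n • u) +
        (π.s ^ (n + m + 1) * t ^ (n + m + 3) * z ^ (n + 3) * r) •
          ((π.s * b) • Pi.single π.col 1) := by
      rw [map_smul, huv]
      have e : (π.s ^ (n + m + 1) * t ^ (n + m + 3) * z ^ (n + 3) * r) •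
          ((π.s * b) • (Pi.single π.col 1 : ι → R)) =
          (π.s ^ (n + m + 2) * t ^ (n + m + 3) * z ^ (n + m + 3) * π.μ v) •
          (Pi.single π.col 1 : ι → R) := by
        rw [smul_smul]
        congr 1
        linear_combination -(π.s ^ (n + m + 2) * t ^ (n + m + 3) * z ^ (n + 3)) * hr
      rw [e]
      module
    rw [key]
    exact add_mem (Submodule.smul_mem _ _ (Submodule.mem_sup_left ⟨_, hn, rfl⟩))
      (Submodule.smul_mem _ _ (Submodule.mem_sup_right (Submodule.mem_span_singleton_self _)))

end Pivot

theorem fgNear_of_forall_eq_zero {V : Type*} [AddCommGroup V] [Module R V] {M : Ideal R}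
    [hM : M.IsPrime] {K : Submodule R V} (hK : ∀ x ∈ K, x = 0) : FGNear M K :=
  ⟨⊥, bot_le, Submodule.fg_bot, 1, hM.one_notMem, fun x hx => ⟨0, by simp [hK x hx]⟩⟩

theorem ColonsComaximal.fgNear_ker_of_annPrincipalNear (hR : ColonsComaximal R) {M : Ideal R}
    [hM : M.IsPrime] [Fintype κ] [Nonempty κ] (hann : ∀ a, AnnPrincipalNear M a)
    (T : Finset ι) (φ : (ι → R) →ₗ[R] (κ → R)) :
    FGNear M (LinearMap.ker φ ⊓ supportedOn R T) := by
  induction T using Finset.strongInduction generalizing φ with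
  | H T ih =>
    rcases T.eq_empty_or_nonempty with rfl | hT
    · exact fgNear_of_forall_eq_zero fun x hx => eq_zero_of_mem_supportedOn_empty hx.2
    · obtain ⟨π⟩ := hR.nonempty_pivot M φ hT
      exact π.fgNear_ker (hann _) (ih _ (Finset.erase_ssubset π.col_mem) _)

theorem ColonsComaximal.annPrincipalAt_of_annPrincipalAt (hR : ColonsComaximal R) {M : Ideal R}
    [hM : M.IsPrime] {a c : R} (hca : c * a = 0)
    (h : ∀ x, c * x = 0 → ∃ s ∉ M, ∃ r, s * x = r * a) : AnnPrincipalAt M a := by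
  by_cases ha0 : ∃ u ∉ M, u * a = 0
  · obtain ⟨u, hu, hua⟩ := ha0
    exact ⟨u, by rw [mul_comm, hua], fun x _ => ⟨u, hu, x, mul_comm _ _⟩⟩
  · push Not at ha0
    exact ⟨c, by rw [mul_comm, hca], fun x hx => hR.exists_mul_eq_of_annihilator h ha0 hx⟩

theorem ColonsComaximal.fgNear_ker_of_exact (hR : ColonsComaximal R) {M : Ideal R}
    [hM : M.IsMaximal] [Fintype κ] [Nonempty κ]
    (T : Finset ι) (φ : (ι → R) →ₗ[R] (κ → R)) (m : ℕ) (g : Fin m → (κ → R) →ₗ[R] R)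
    (hg : ∀ w ∈ supportedOn R T, ∀ i, g i (φ w) = 0)
    (hgφ : ∀ v, (∀ i, g i v = 0) → ∃ s ∉ M, ∃ w ∈ supportedOn R T, s • v = φ w) :
    FGNear M (LinearMap.ker φ ⊓ supportedOn R T) := by
  have hMp := hM.isPrime
  induction T using Finset.strongInduction generalizing φ m g with
  | H T ih =>
    rcases T.eq_empty_or_nonempty with rfl | hT
    · exact fgNear_of_forall_eq_zero fun x hx => eq_zero_of_mem_supportedOn_empty hx.2
    obtain ⟨π⟩ := hR.nonempty_pivot M φ hT
    refine π.fgNear_ker (hR.annPrincipalNear ?_)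
      (ih _ (Finset.erase_ssubset π.col_mem) _ (m + 1) (Fin.cons (LinearMap.proj π.row) g) ?_ ?_)
    · have hge : ∀ i, π.a * g i π.e = 0 := by
        intro i
        rw [← smul_eq_mul, ← map_smul, ← π.smul_map_single, map_smul,
          hg _ (single_mem_supportedOn π.col_mem 1), smul_zero]
      obtain ⟨c, hca, t, ht, htc⟩ : ∃ c, c * π.a = 0 ∧ ∃ t ∉ M, ∀ i, ∃ r, t * g i π.e = r * c := by
        rcases Nat.eq_zero_or_pos m with rfl | hm
        · exact ⟨0, zero_mul _, 1, hMp.one_notMem, fun i => i.elim0⟩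
        · have : Nonempty (Fin m) := ⟨⟨0, hm⟩⟩
          obtain ⟨k, -, t, ht, h⟩ := hR.exists_dvd_at M Finset.univ_nonempty (fun i => g i π.e)
          exact ⟨g k π.e, by rw [mul_comm, hge], t, ht, fun i => h i (Finset.mem_univ i)⟩
      refine hR.annPrincipalAt_of_annPrincipalAt hca fun x hx => ?_
      obtain ⟨z, hz, w, hw, hzw⟩ := hgφ ((t * x) • π.e) (by
        intro i
        obtain ⟨r, hr⟩ := htc i
        rw [map_smul, smul_eq_mul]
        linear_combination x * hr + r * hx)
      have h1 := congrFun hzw π.row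
      simp only [Pi.smul_apply, smul_eq_mul, π.e_row] at h1
      refine ⟨π.s * z * t * π.s, hMp.mul_notMem (hMp.mul_notMem (hMp.mul_notMem π.s_notMem hz) ht)
        π.s_notMem, π.μ w, ?_⟩
      linear_combination π.s * h1 + π.mul_map_row w hw
    · intro w hw i
      refine Fin.cases ?_ (fun i => ?_) i
      · simp only [Fin.cons_zero, LinearMap.proj_apply, LinearMap.comp_apply]
        exact π.map_clear_row fun i hi => hw i fun h => hi (Finset.mem_of_mem_erase h)
      · simpa using hg _ (π.clear_mem hw) i
    · intro v hv
      have hv0 : v π.row = 0 := by simpa using hv 0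
      obtain ⟨z, hz, w, hw, hzw⟩ := hgφ v fun i => by simpa using hv i.succ
      have hμ : π.μ w * π.a = 0 := by
        rw [← π.mul_map_row w hw, ← hzw, Pi.smul_apply, hv0, smul_zero, mul_zero]
      obtain ⟨u, hu, huw⟩ := π.exists_clear_eq hw
      refine ⟨π.s ^ 3 * z, fun h => ?_, u, hu, ?_⟩
      · exact (hMp.mem_or_mem h).elim (fun h => π.s_notMem (hMp.mem_of_pow_mem _ h)) hz
      · rw [LinearMap.comp_apply, huw, map_smul, sq, mul_smul π.s π.s, π.map_smul_sub hμ, ← hzw]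
        module

theorem inf_supportedOn_univ {ι : Type*} [Fintype ι] (K : Submodule R (ι → R)) :
    K ⊓ supportedOn R Finset.univ = K :=
  inf_eq_left.2 fun _ _ i hi => (hi (Finset.mem_univ i)).elim

theorem ColonsComaximal.ker_fg_of_exact (hR : ColonsComaximal R) {p q m : ℕ}
    (φ : (Fin p → R) →ₗ[R] (Fin q → R)) (g : (Fin q → R) →ₗ[R] (Fin m → R))
    (h : LinearMap.range φ = LinearMap.ker g) : (LinearMap.ker φ).FG := by
  rcases Nat.eq_zero_or_pos q with rfl | hq
  · have : LinearMap.ker φ = ⊤ := by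
      rw [eq_top_iff]
      exact fun x _ => Subsingleton.elim _ _
    exact this ▸ Module.Finite.fg_top
  have : Nonempty (Fin q) := ⟨⟨0, hq⟩⟩
  refine Submodule.fg_of_forall_fgNear fun M hM => ?_
  rw [← inf_supportedOn_univ (LinearMap.ker φ)]
  refine hR.fgNear_ker_of_exact _ φ m (fun i => LinearMap.proj i ∘ₗ g) (fun w _ i => ?_)
    fun v hv => ?_
  · have hw : φ w ∈ LinearMap.ker g := h ▸ LinearMap.mem_range_self φ w
    rw [LinearMap.comp_apply, LinearMap.mem_ker.1 hw, map_zero]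
  · obtain ⟨w, hw⟩ : v ∈ LinearMap.range φ := h ▸ LinearMap.mem_ker.2 (funext hv)
    exact ⟨1, hM.isPrime.one_notMem, w, fun i hi => (hi (Finset.mem_univ i)).elim,
      by rw [one_smul, hw]⟩

/-- A map of finite free modules with finitely generated kernel. -/
structure FreeMapWithFGKer (R : Type u) [CommRing R] where
  source : ℕ
  target : ℕ
  toLinearMap : (Fin source → R) →ₗ[R] (Fin target → R)
  ker_fg : (LinearMap.ker toLinearMap).FG

theorem lambdaDimLE_two_of_ker_fg
    (H : ∀ (p q m : ℕ) (φ : (Fin p → R) →ₗ[R] (Fin q → R)) (g : (Fin q → R) →ₗ[R] (Fin m → R)),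
      LinearMap.range φ = LinearMap.ker g → (LinearMap.ker φ).FG) :
    LambdaDimLE R 2 := by
  rintro E _ _ ⟨k, f, g, hg, hfg, hf⟩ m
  have hstep (x : FreeMapWithFGKer R) :
      ∃ (p : ℕ) (φ : (Fin p → R) →ₗ[R] (Fin x.source → R)),
        LinearMap.range φ = LinearMap.ker x.toLinearMap :=
    (Submodule.fg_iff_exists_fin_linearMap _ _).1 x.ker_fg
  choose p φ hφ using hstep
  let next (x : FreeMapWithFGKer R) : FreeMapWithFGKer R :=
    ⟨p x, x.source, φ x, H _ _ _ _ _ (hφ x)⟩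
  have h1 : (LinearMap.ker (f 0)).FG := hf 0 (by norm_num) ▸ Submodule.fg_range _
  let x : ℕ → FreeMapWithFGKer R := fun i => i.rec ⟨k 1, k 0, f 0, h1⟩ fun _ => next
  exact ⟨fun i => (x i).target, fun i => (x i).toLinearMap, g, hg, fun _ => hfg (by norm_num),
    fun i _ => hφ (x i)⟩

theorem IsCoherentRing.annPrincipalAt (hR : ColonsComaximal R) {M : Ideal R} [hM : M.IsPrime]
    (h : IsCoherentRing (Localization.AtPrime M)) (a : R) : AnnPrincipalAt M a := by
  classical
  let S := Localization.AtPrime M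
  let a' : S := algebraMap R S a
  have := h (LinearMap.range (LinearMap.toSpanSingleton S S a')) (Submodule.fg_range _)
  obtain ⟨G, hG⟩ := Module.FinitePresentation.fg_ker
    (LinearMap.toSpanSingleton S S a').rangeRestrict (LinearMap.surjective_rangeRestrict _)
  rw [LinearMap.ker_rangeRestrict] at hG
  have hnum (g : S) : ∃ b : R, a * b = 0 ∧ (g ∈ G → ∃ r : S, g = r * algebraMap R S b) := by
    by_cases hg : g ∈ G
    · obtain ⟨⟨b, s⟩, hb⟩ := IsLocalization.surj M.primeCompl g
      have hag : g * a' = 0 := by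
        have : g ∈ LinearMap.ker (LinearMap.toSpanSingleton S S a') :=
          hG ▸ Submodule.subset_span hg
        simpa using this
      have hab : algebraMap R S (a * b) = 0 := by
        rw [map_mul, ← hb]
        linear_combination algebraMap R S s * hag
      obtain ⟨t, ht⟩ := (IsLocalization.map_eq_zero_iff M.primeCompl S _).1 hab
      obtain ⟨u, hu⟩ := ((IsLocalization.map_units S s).mul
        (IsLocalization.map_units S t)).exists_left_inv
      refine ⟨t * b, by linear_combination ht, fun _ => ⟨u, ?_⟩⟩
      rw [map_mul, ← hb]
      linear_combination -g * hu
    · exact ⟨0, mul_zero a, fun h => (hg h).elim⟩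
  choose b hab hb using hnum
  obtain ⟨k, -, s, hs, hsk⟩ := hR.exists_dvd_at M (Finset.insert_nonempty 0 G) b
  have hle : LinearMap.ker (LinearMap.toSpanSingleton S S a') ≤
      Ideal.span {algebraMap R S (b k)} := by
    rw [← hG, Submodule.span_le]
    intro g hg
    obtain ⟨r, hr⟩ := hb g hg
    obtain ⟨q, hq⟩ := hsk g (Finset.mem_insert_of_mem hg)
    obtain ⟨u, hu⟩ := (IsLocalization.map_units S (⟨s, hs⟩ : M.primeCompl)).exists_left_inv
    have hq' := congrArg (algebraMap R S) hq
    rw [map_mul, map_mul] at hq'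
    refine Ideal.mem_span_singleton'.2 ⟨r * u * algebraMap R S q, ?_⟩
    rw [hr]
    linear_combination r * algebraMap R S (b g) * hu - r * u * hq'
  refine ⟨b k, hab k, fun x hx => ?_⟩
  have hx' : algebraMap R S x ∈ LinearMap.ker (LinearMap.toSpanSingleton S S a') := by
    rw [LinearMap.mem_ker, LinearMap.toSpanSingleton_apply, smul_eq_mul, ← map_mul, mul_comm, hx,
      map_zero]
  obtain ⟨y, hy⟩ := Ideal.mem_span_singleton'.1 (hle hx')
  obtain ⟨⟨r, t⟩, hr⟩ := IsLocalization.surj M.primeCompl y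
  have he : algebraMap R S (t * x) = algebraMap R S (r * b k) := by
    rw [map_mul, map_mul, ← hr, ← hy]
    ring
  obtain ⟨c, hc⟩ := (IsLocalization.eq_iff_exists M.primeCompl S).1 he
  exact ⟨c * t, hM.mul_notMem c.2 t.2, c * r, by linear_combination hc⟩

theorem ColonsComaximal.isCoherentRing_of_annPrincipalNear (hR : ColonsComaximal R)
    (h : ∀ M : Ideal R, M.IsMaximal → ∀ a, AnnPrincipalNear M a) : IsCoherentRing R := by
  intro I hI
  obtain ⟨n, f, rfl⟩ := (Submodule.fg_iff_exists_fin_linearMap _ _).1 hI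
  refine Module.finitePresentation_of_surjective f.rangeRestrict
    (LinearMap.surjective_rangeRestrict _) ?_
  rw [LinearMap.ker_rangeRestrict]
  let φ : (Fin n → R) →ₗ[R] (Unit → R) := LinearMap.pi fun _ => f
  have hφ : LinearMap.ker f = LinearMap.ker φ := by
    ext x
    simp [φ, funext_iff]
  rw [hφ]
  refine Submodule.fg_of_forall_fgNear fun M hM => ?_
  have := hM.isPrime
  rw [← inf_supportedOn_univ (LinearMap.ker φ)]
  exact hR.fgNear_ker_of_annPrincipalNear (h M hM) _ φ

theorem IsCoherentRing.of_isLocalization {S : Type u} [CommRing S] [Algebra R S] (N : Submonoid R)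
    [IsLocalization N S] (h : IsCoherentRing R) : IsCoherentRing S := by
  classical
  rintro _ ⟨G, rfl⟩
  choose x hx using IsLocalization.surj N (S := S)
  let I : Ideal R := Ideal.span (G.image fun g => (x g).1 : Finset R)
  have hI : I.map (algebraMap R S) = Ideal.span G := by
    rw [Ideal.map_span]
    apply le_antisymm <;> rw [Ideal.span_le]
    · rintro _ ⟨r, hr, rfl⟩
      obtain ⟨g, hg, rfl⟩ := Finset.mem_image.1 hr
      rw [SetLike.mem_coe, ← hx]
      exact Ideal.mul_mem_right _ _ (Ideal.subset_span hg)
    · intro g hg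
      refine (Ideal.mul_unit_mem_iff_mem _ (IsLocalization.map_units S (x g).2)).1 ?_
      rw [hx]
      exact Ideal.subset_span ⟨_, Finset.mem_image_of_mem _ hg, rfl⟩
  have := h I ⟨_, rfl⟩
  change Module.FinitePresentation S (Ideal.span (G : Set S))
  rw [← hI]
  exact FinitePresentation.of_isBaseChange (Algebra.idealMap S I)
    ((isLocalizedModule_iff_isBaseChange N S _).1 inferInstance)

end

/-- A commutative CF-ring has `λ`-dimension at most 2, and is coherent
iff it is locally coherent. -/
theorem lambdaDim_le_two_of_isCFRing (R : Type u) [CommRing R] (hR : IsCFRing R) :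
    LambdaDimLE R 2 ∧
    (IsCoherentRing R ↔ ∀ (M : Ideal R) (hM : M.IsMaximal),
      letI := hM.isPrime
      IsCoherentRing (Localization.AtPrime M)) := by
  have hC := hR.colonsComaximal
  refine ⟨lambdaDimLE_two_of_ker_fg fun _ _ _ => hC.ker_fg_of_exact,
    fun h M hM => h.of_isLocalization M.primeCompl,
    fun h => hC.isCoherentRing_of_annPrincipalNear fun M hM a => ?_⟩
  have := hM.isPrime
  exact hC.annPrincipalNear ((h M hM).annPrincipalAt hC a)
end

section
/- Let R be a commutative fractionally self fp-injective ring. Then for every proper ideal A of R the minimal prime spectrum MinSpec(R/A) is a compact topological space; moreover, if A is a semi-prime (radical) ideal, then R/A is a semihereditary ring. -/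
open DirectSum

universe u

open CategoryTheory in
/-- If `Ext¹(F, Y)` vanishes, every `1`-cocycle of a projective resolution of `F` with values in `Y`
is a coboundary. -/
lemma exists_eq_d_comp_of_subsingleton_ext {R : Type u} [CommRing R] {F Y : ModuleCat.{u} R}
    (P : ProjectiveResolution F)
    (h : Subsingleton (((Ext R (ModuleCat.{u} R) 1).obj (Opposite.op F)).obj Y))
    (f : P.complex.X 1 ⟶ Y) (hf : P.complex.d 2 1 ≫ f = 0) :
    ∃ g : P.complex.X 0 ⟶ Y, P.complex.d 1 0 ≫ g = f := by
  have h0 : Limits.IsZero ((P.complex.linearYonedaObj R Y).homology 1) :=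
    (ModuleCat.isZero_of_subsingleton _).of_iso (P.isoExt 1 Y).symm
  rw [← HomologicalComplex.exactAt_iff_isZero_homology,
    HomologicalComplex.exactAt_iff' _ 0 1 2 (by simp) (by simp),
    ShortComplex.moduleCat_exact_iff] at h0
  exact h0 f hf

open CategoryTheory in
/-- Every homomorphism from a finitely generated ideal of a self fp-injective ring to the ring is
a multiplication. -/
lemma SelfFPInjective.exists_forall_eq_mul {R : Type u} [CommRing R] (h : SelfFPInjective R)
    {I : Ideal R} (hI : I.FG) (f : I →ₗ[R] R) : ∃ y : R, ∀ z : I, f z = z * y := by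
  let F : ModuleCat.{u} R := ModuleCat.of R (R ⧸ I)
  have hF : Module.FinitePresentation R F :=
    Module.finitePresentation_of_surjective I.mkQ I.mkQ_surjective (by rwa [I.ker_mkQ])
  let P : ProjectiveResolution F := projectiveResolution F
  let ε : P.complex.X 0 →ₗ[R] R ⧸ I := (P.π.f 0).hom
  have hε : Function.Surjective ε := (ModuleCat.epi_iff_surjective (P.π.f 0)).1 inferInstance
  let d : P.complex.X 1 →ₗ[R] P.complex.X 0 := (P.complex.d 1 0).hom
  have hεd (p) : ε (d p) = 0 :=
    congrArg (fun f => f.hom p) P.complex_d_comp_π_f_zero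
  have hex (x) (hx : ε x = 0) : ∃ p, d p = x := by
    have := ShortComplex.exact_of_g_is_cokernel (ShortComplex.mk _ _ P.complex_d_comp_π_f_zero)
      P.isColimitCokernelCofork
    exact (ShortComplex.moduleCat_exact_iff _).1 this x hx
  have : Module.Projective R (P.complex.X 0) :=
    (IsProjective.iff_projective _).2 (P.projective 0)
  obtain ⟨l, hl⟩ := Module.projective_lifting_property I.mkQ ε I.mkQ_surjective
  have hl' (x) : I.mkQ (l x) = ε x := LinearMap.congr_fun hl x
  obtain ⟨k, hk⟩ := Module.projective_lifting_property ε I.mkQ hε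
  have hk' (x) : ε (k x) = I.mkQ x := LinearMap.congr_fun hk x
  have hld (p) : l (d p) ∈ I := by
    rw [← Submodule.Quotient.mk_eq_zero]; exact (hl' _).trans (hεd p)
  let φ : P.complex.X 1 →ₗ[R] R := f ∘ₗ (l ∘ₗ d).codRestrict I hld
  obtain ⟨g, hg⟩ := exists_eq_d_comp_of_subsingleton_ext P (h F hF) (ModuleCat.ofHom φ) (by
    ext p
    have h2 : d ((P.complex.d 2 1).hom p) = 0 :=
      congrArg (fun f => f.hom p) (P.complex.d_comp_d 2 1 0)
    have : (l ∘ₗ d).codRestrict I hld ((P.complex.d 2 1).hom p) = 0 :=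
      Subtype.ext ((congrArg l h2).trans (map_zero l))
    exact (congrArg f this).trans (map_zero f))
  have hg' (p) : g.hom (d p) = f ⟨l (d p), hld p⟩ := congrArg (fun f => f.hom p) hg
  have hw : l (k 1) - 1 ∈ I := by
    rw [← Submodule.Quotient.mk_eq_zero, Submodule.Quotient.mk_sub, sub_eq_zero]
    exact (hl' _).trans (hk' _)
  refine ⟨g.hom (k 1) - f ⟨_, hw⟩, fun z => ?_⟩
  obtain ⟨p, hp⟩ := hex (k z) (by rw [hk']; exact (Submodule.Quotient.mk_eq_zero I).2 z.2)
  have hkz : k z = (z : R) • k 1 := by rw [← map_smul]; simp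
  have h1 : (z : R) * g.hom (k 1) = f ⟨l (d p), hld p⟩ := by
    rw [← hg', hp, hkz, map_smul, smul_eq_mul]
  have h2 : (⟨l (d p), hld p⟩ : I) = z + (z : R) • ⟨_, hw⟩ := by
    ext; simp [hp, hkz]; ring
  rw [mul_sub, h1, h2, map_add, map_smul, smul_eq_mul]; ring

/-- Principal ideals of a self fp-injective ring are annihilators. -/
lemma SelfFPInjective.dvd_of_forall_mul_eq_zero {R : Type u} [CommRing R] (h : SelfFPInjective R)
    {a b : R} (hab : ∀ x, x * a = 0 → x * b = 0) : a ∣ b := by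
  let q : R →ₗ[R] Ideal.span {a} :=
    (LinearMap.toSpanSingleton R R a).codRestrict _ fun x =>
      Ideal.mul_mem_left _ _ (Ideal.mem_span_singleton_self a)
  have hq : Function.Surjective q := fun ⟨y, hy⟩ => by
    obtain ⟨x, rfl⟩ := Ideal.mem_span_singleton'.1 hy
    exact ⟨x, rfl⟩
  have hker : LinearMap.ker q ≤ LinearMap.ker (LinearMap.toSpanSingleton R R b) := fun x hx =>
    hab x (congrArg Subtype.val (LinearMap.mem_ker.1 hx))
  let f : Ideal.span {a} →ₗ[R] R :=
    (LinearMap.ker q).liftQ _ hker ∘ₗ (q.quotKerEquivOfSurjective hq).symm.toLinearMap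
  have hf : f (q 1) = b := by
    have : (q.quotKerEquivOfSurjective hq).symm (q 1) = Submodule.Quotient.mk 1 := by
      rw [LinearEquiv.symm_apply_eq]; rfl
    exact (congrArg ((LinearMap.ker q).liftQ _ hker) this).trans (one_smul R b)
  obtain ⟨y, hy⟩ := h.exists_forall_eq_mul (Submodule.fg_span_singleton a) f
  exact ⟨y, by rw [← hf, hy]; exact congrArg (· * y) (one_smul R a)⟩

/-- In a ring whose classical quotient ring is self fp-injective, `b` is a multiple of `a` up to a
non-zero-divisor as soon as the annihilator of `a` kills `b`. -/
lemma exists_mul_eq_mul_of_selfFPInjective {B : Type u} [CommRing B]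
    (h : SelfFPInjective (FractionRing B)) {a b : B} (hab : ∀ x, x * a = 0 → x * b = 0) :
    ∃ s ∈ nonZeroDivisors B, ∃ c, s * b = c * a := by
  have hinj : Function.Injective (algebraMap B (FractionRing B)) :=
    IsLocalization.injective _ le_rfl
  obtain ⟨q, hq⟩ := h.dvd_of_forall_mul_eq_zero (a := algebraMap B (FractionRing B) a)
    (b := algebraMap B (FractionRing B) b) (fun x hx => by
      obtain ⟨⟨n, s⟩, hn⟩ := IsLocalization.surj (nonZeroDivisors B) x
      have hna : n * a = 0 := hinj (by
        rw [map_mul, ← hn, map_zero, mul_right_comm, hx, zero_mul])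
      have hs := IsLocalization.map_units (FractionRing B) s
      rw [← hs.mul_left_inj, zero_mul, mul_right_comm, hn, ← map_mul, hab n hna, map_zero])
  obtain ⟨⟨n, s⟩, hn⟩ := IsLocalization.surj (nonZeroDivisors B) q
  refine ⟨s, s.2, n, hinj ?_⟩
  rw [map_mul, map_mul, hq, ← hn]
  ring

/-- A fractionally self fp-injective ring is arithmetic, in elementwise form. -/
lemma FractionallySelfFPInjective.exists_mul_eq_mul {R : Type u} [CommRing R]
    (hR : FractionallySelfFPInjective R) (a b : R) :
    ∃ u v w, u * a = v * b ∧ (1 - u) * b = w * a := by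
  let C (x y : R) : Ideal R := Submodule.comap (LinearMap.toSpanSingleton R R x) (Ideal.span {y})
  have hC {x y r : R} : r ∈ C x y ↔ ∃ t, t * y = r * x := Ideal.mem_span_singleton'
  suffices htop : C a b ⊔ C b a = ⊤ by
    obtain ⟨u, hu, u', hu', huu⟩ := Submodule.mem_sup.1 (htop ▸ Submodule.mem_top : (1 : R) ∈ _)
    obtain rfl : u' = 1 - u := by rw [← huu]; ring
    obtain ⟨v, hv⟩ := hC.1 hu
    obtain ⟨w, hw⟩ := hC.1 hu'
    exact ⟨u, v, w, hv.symm, hw.symm⟩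
  by_contra hne
  obtain ⟨M, hM, hle⟩ := Ideal.exists_le_maximal _ hne
  have hab : ∀ r ∈ C a b, r ∈ M := fun r hr => hle (Ideal.mem_sup_left hr)
  have hba : ∀ r ∈ C b a, r ∈ M := fun r hr => hle (Ideal.mem_sup_right hr)
  have hsub {r m : R} (h : r - m ∈ M) (hm : m ∈ M) : r ∈ M := by
    simpa using M.add_mem h hm
  have h1 : (1 : R) ∉ M := fun h => hM.ne_top ((Ideal.eq_top_iff_one _).2 h)
  let A : Ideal R := M * Ideal.span {a} ⊔ M * Ideal.span {b}
  have hA {x : R} : x ∈ A ↔ ∃ m ∈ M, ∃ m' ∈ M, m * a + m' * b = x := by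
    simp only [A, Submodule.mem_sup, Ideal.mem_mul_span_singleton]
    constructor
    · rintro ⟨_, ⟨m, hm, rfl⟩, _, ⟨m', hm', rfl⟩, h⟩
      exact ⟨m, hm, m', hm', h⟩
    · rintro ⟨m, hm, m', hm', h⟩
      exact ⟨_, ⟨m, hm, rfl⟩, _, ⟨m', hm', rfl⟩, h⟩
  have hMa {r : R} (hr : r ∈ M) : r * a ∈ A := hA.2 ⟨r, hr, 0, M.zero_mem, by ring⟩
  have hMb {r : R} (hr : r ∈ M) : r * b ∈ A := hA.2 ⟨0, M.zero_mem, r, hr, by ring⟩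
  have haA : a ∉ A := fun h => by
    obtain ⟨m, hm, m', -, h⟩ := hA.1 h
    exact h1 (hsub (hab _ (hC.2 ⟨m', by linear_combination h⟩)) hm)
  have hAtop : A ≠ ⊤ := fun h => haA (h ▸ Submodule.mem_top)
  obtain ⟨s, hs, c, hsc⟩ := exists_mul_eq_mul_of_selfFPInjective (hR A hAtop)
    (a := Ideal.Quotient.mk A a) (b := Ideal.Quotient.mk A b) (fun x hx => by
      obtain ⟨r, rfl⟩ := Ideal.Quotient.mk_surjective x
      rw [← map_mul, Ideal.Quotient.eq_zero_iff_mem] at hx ⊢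
      refine hMb (by_contra fun hr => haA ?_)
      obtain ⟨y, m, hm, hy⟩ := hM.exists_inv hr
      have : a = y * (r * a) + m * a := by linear_combination (-a) * hy
      rw [this]
      exact A.add_mem (A.mul_mem_left _ hx) (hMa hm))
  obtain ⟨s, rfl⟩ := Ideal.Quotient.mk_surjective s
  obtain ⟨c, rfl⟩ := Ideal.Quotient.mk_surjective c
  have hsM : s ∉ M := fun h => haA (by
    rw [← Ideal.Quotient.eq_zero_iff_mem]
    refine (mem_nonZeroDivisors_iff.1 hs).1 _ ?_
    rw [← map_mul]
    exact Ideal.Quotient.eq_zero_iff_mem.2 (hMa h))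
  rw [← map_mul, ← map_mul, Ideal.Quotient.mk_eq_mk_iff_sub_mem] at hsc
  obtain ⟨m, hm, m', hm', h⟩ := hA.1 hsc
  exact hsM (hsub (hba _ (hC.2 ⟨c + m, by linear_combination h⟩)) hm')

/-- A reduced ring whose classical quotient ring is self fp-injective has von Neumann regular
classical quotient ring, in elementwise form. -/
lemma exists_mul_eq_sq_mul {B : Type u} [CommRing B] [IsReduced B]
    (h : SelfFPInjective (FractionRing B)) (a : B) :
    ∃ s ∈ nonZeroDivisors B, ∃ c, s * a = c * a ^ 2 :=
  exists_mul_eq_mul_of_selfFPInjective h fun x hx =>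
    eq_zero_of_pow_eq_zero (n := 2) (by linear_combination x * hx)

/-- If `Q(B)` is self fp-injective and `B` is reduced and arithmetic, then principal ideals
have idempotent-generated annihilators. -/
lemma exists_mul_self_eq_of_exists_mul_eq_mul {B : Type u} [CommRing B] [IsReduced B]
    (h : SelfFPInjective (FractionRing B))
    (hB : ∀ a b : B, ∃ u v w, u * a = v * b ∧ (1 - u) * b = w * a) (a : B) :
    ∃ e, e * a = a ∧ ∀ x, x * a = 0 → x * e = 0 := by
  obtain ⟨s, hs, c, hsc⟩ := exists_mul_eq_sq_mul h a
  obtain ⟨u, v, w, huv, huw⟩ := hB (a * c) s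
  have hcancel {x y : B} (hxy : s * x = s * y) : x = y :=
    (mul_cancel_left_mem_nonZeroDivisors hs).1 hxy
  have h1 : (1 - u) * (a * c) = (1 - u) * s :=
    hcancel (by linear_combination (a * c - s) * huw - w * c * hsc)
  have h2 : s * (v + 1 - u) = a * c := by linear_combination -huv - h1
  refine ⟨v + 1 - u, hcancel (by linear_combination a * h2 - hsc), fun x hx => hcancel ?_⟩
  linear_combination x * h2 + c * hx

/-- A finitely generated ideal of an arithmetic ring is locally principal. -/
lemma exists_notMem_forall_mul_mem_span {B : Type u} [CommRing B]
    (hB : ∀ a b : B, ∃ u v w, u * a = v * b ∧ (1 - u) * b = w * a)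
    (M : Ideal B) [M.IsPrime] {I : Ideal B} (hI : I.FG) :
    ∃ a ∈ I, ∃ s ∉ M, ∀ x ∈ I, s * x ∈ Ideal.span {a} := by
  have h1 : (1 : B) ∉ M := fun h => ‹M.IsPrime›.ne_top ((Ideal.eq_top_iff_one _).2 h)
  induction I, hI using Submodule.fg_induction with
  | singleton x =>
    exact ⟨x, Submodule.mem_span_singleton_self x, 1, h1, fun y hy => by rwa [one_mul]⟩
  | sup I J _ _ hI hJ =>
    obtain ⟨a, ha, s, hs, hsI⟩ := hI
    obtain ⟨b, hb, t, ht, htJ⟩ := hJ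
    have hst : s * t ∉ M := fun h => (‹M.IsPrime›.mem_or_mem h).elim hs ht
    obtain ⟨u, v, w, huv, huw⟩ := hB a b
    simp only [Ideal.mem_span_singleton', Submodule.mem_sup] at hsI htJ ⊢
    by_cases hu : u ∈ M
    · have hu' : 1 - u ∉ M := fun h => h1 (by simpa using M.add_mem h hu)
      refine ⟨a, ⟨a, ha, 0, zero_mem _, add_zero a⟩, s * t * (1 - u),
        fun h => (‹M.IsPrime›.mem_or_mem h).elim hst hu', ?_⟩
      rintro _ ⟨x, hx, y, hy, rfl⟩
      obtain ⟨p, hp⟩ := hsI x hx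
      obtain ⟨q, hq⟩ := htJ y hy
      exact ⟨t * (1 - u) * p + s * q * w, by
        linear_combination t * (1 - u) * hp + s * (1 - u) * hq - s * q * huw⟩
    · refine ⟨b, ⟨0, zero_mem _, b, hb, zero_add b⟩, s * t * u,
        fun h => (‹M.IsPrime›.mem_or_mem h).elim hst hu, ?_⟩
      rintro _ ⟨x, hx, y, hy, rfl⟩
      obtain ⟨p, hp⟩ := hsI x hx
      obtain ⟨q, hq⟩ := htJ y hy
      exact ⟨t * p * v + s * u * q, by
        linear_combination t * u * hp + s * u * hq - t * p * huv⟩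

/-- An arithmetic ring whose principal ideals are projective is semihereditary. -/
lemma Ideal.projective_of_fg_of_exists_mul_eq_mul {B : Type u} [CommRing B]
    (hB : ∀ a b : B, ∃ u v w, u * a = v * b ∧ (1 - u) * b = w * a)
    (he : ∀ a : B, ∃ e, e * a = a ∧ ∀ x, x * a = 0 → x * e = 0)
    {I : Ideal B} (hI : I.FG) : Module.Projective B I := by
  let π : (I →₀ B) →ₗ[B] I := Finsupp.linearCombination B id
  let J : Ideal B := (LinearMap.range (π.compRight B (M := I))).comap
    (LinearMap.toSpanSingleton B (I →ₗ[B] I) LinearMap.id)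
  suffices hJ : J = ⊤ by
    obtain ⟨f, hf⟩ : (1 : B) ∈ J := hJ ▸ Submodule.mem_top
    exact Module.projective_def'.2 ⟨f, hf.trans (one_smul B _)⟩
  by_contra hne
  obtain ⟨M, hM, hle⟩ := Ideal.exists_le_maximal J hne
  obtain ⟨a, ha, s, hs, hsI⟩ := exists_notMem_forall_mul_mem_span hB M hI
  obtain ⟨e, hea, hae⟩ := he a
  choose y hy using fun x : I => Ideal.mem_span_singleton'.1 (hsI x x.2)
  have hcancel {x z : B} (hxz : x * a = z * a) : x * e = z * e := by
    rw [← sub_eq_zero, ← sub_mul]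
    exact hae _ (by rw [sub_mul, hxz, sub_self])
  let f : I →ₗ[B] B :=
    { toFun x := y x * e
      map_add' x z := by
        rw [← add_mul]
        exact hcancel (by rw [add_mul, hy, hy, hy, Submodule.coe_add, mul_add])
      map_smul' r x := by
        rw [RingHom.id_apply, smul_eq_mul, ← mul_assoc]
        exact hcancel (by rw [mul_assoc, hy, hy]; simp; ring) }
  refine hs (hle ⟨Finsupp.lsingle ⟨a, ha⟩ ∘ₗ f, ?_⟩)
  ext x
  have : y x * e * a = s * x := by rw [mul_assoc, hea, hy]
  change (π (Finsupp.single ⟨a, ha⟩ (f x)) : B) = s * x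
  rw [Finsupp.linearCombination_single]
  exact this

/-- If `B` is a reduced quotient of `S` by a nil ideal and `Q(B)` is self fp-injective, then the
minimal prime spectrum of `S` is compact: it is the image of `Spec Q(B)`. -/
lemma MinSpec.compactSpace_of_surjective {S B : Type u} [CommRing S] [CommRing B] [IsReduced B]
    (h : SelfFPInjective (FractionRing B)) (π : S →+* B) (hπ : Function.Surjective π)
    (hker : RingHom.ker π ≤ nilradical S) : CompactSpace (MinSpec S) := by
  have hdisj {p q : Ideal B} [p.IsPrime] [q.IsPrime]
      (hp : Disjoint (nonZeroDivisors B : Set B) p) (hqp : q ≤ p) : p ≤ q := by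
    intro a ha
    obtain ⟨s, hs, c, hsc⟩ := exists_mul_eq_sq_mul h a
    by_contra haq
    have h0 : a * (s - c * a) = 0 := by linear_combination hsc
    have hmem : s - c * a ∈ q :=
      (‹q.IsPrime›.mem_or_mem (h0 ▸ q.zero_mem)).resolve_left haq
    exact Set.disjoint_left.1 hp hs (by simpa using p.add_mem (hqp hmem) (p.mul_mem_left c ha))
  have hsurj (P : Ideal S) [P.IsPrime] : ∃ p : Ideal B, p.IsPrime ∧ p.comap π = P := by
    have hP : RingHom.ker π ≤ P := hker.trans (nilradical_le_prime P)
    exact ⟨P.map π, Ideal.map_isPrime_of_surjective hπ hP, by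
      rw [Ideal.comap_map_of_surjective π hπ, sup_eq_left]; exact hP⟩
  have hle {p q : Ideal B} : p.comap π ≤ q.comap π ↔ p ≤ q :=
    Ideal.comap_le_comap_iff_of_surjective π hπ p q
  have hrange : {P : PrimeSpectrum S | P.asIdeal ∈ minimalPrimes S} =
      Set.range (PrimeSpectrum.comap π ∘ PrimeSpectrum.comap (algebraMap B (FractionRing B))) := by
    rw [Set.range_comp, PrimeSpectrum.localization_comap_range _ (nonZeroDivisors B)]
    ext P
    simp only [minimalPrimes_eq_minimals, Set.mem_ofPred_eq, Set.mem_image]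
    constructor
    · intro hP
      obtain ⟨p, hp, hpP⟩ := hsurj P.asIdeal
      refine ⟨⟨p, hp⟩, (Ideal.disjoint_nonZeroDivisors_of_mem_minimalPrimes ?_).symm,
        PrimeSpectrum.ext hpP⟩
      rw [minimalPrimes_eq_minimals]
      refine ⟨hp, fun q hq hqp => hle.1 ?_⟩
      rw [hpP]
      have := hq.comap π
      exact hP.2 this (hpP ▸ hle.2 hqp)
    · rintro ⟨p, hp, rfl⟩
      refine ⟨(PrimeSpectrum.comap π p).2, fun Q hQ hQp => ?_⟩
      obtain ⟨q, hq, rfl⟩ := hsurj Q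
      have := p.2
      exact hle.2 (hdisj hp (hle.1 hQp))
  refine isCompact_iff_compactSpace.1
    (?_ : IsCompact {P : PrimeSpectrum S | P.asIdeal ∈ minimalPrimes S})
  rw [hrange]
  exact isCompact_range (by fun_prop)

/-- If `R` is fractionally self fp-injective, then for every proper ideal
`A`, `MinSpec (R/A)` is compact; moreover if `A` is semi-prime then `R/A` is
semihereditary (every finitely generated ideal is projective). -/
theorem minSpec_compact_and_semihereditary (R : Type u) [CommRing R]
    (hR : FractionallySelfFPInjective R) :
    ∀ A : Ideal R, A ≠ ⊤ →
      CompactSpace (MinSpec (R ⧸ A)) ∧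
      (A.radical = A → ∀ I : Ideal (R ⧸ A), I.FG → Module.Projective (R ⧸ A) I) := by
  intro A hA
  have hrad : A.radical ≠ ⊤ := fun h => hA (Ideal.radical_eq_top.1 h)
  refine ⟨?_, fun hAr I hI => ?_⟩
  · have : IsReduced (R ⧸ A.radical) :=
      (Ideal.isRadical_iff_quotient_reduced _).1 A.radical_isRadical
    refine MinSpec.compactSpace_of_surjective (hR _ hrad) (Ideal.Quotient.factor A.le_radical)
      (Ideal.Quotient.factor_surjective _) fun x hx => ?_
    obtain ⟨r, rfl⟩ := Ideal.Quotient.mk_surjective x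
    rw [RingHom.mem_ker, Ideal.Quotient.factor_mk, Ideal.Quotient.eq_zero_iff_mem] at hx
    obtain ⟨n, hn⟩ := hx
    exact ⟨n, (map_pow _ r n).symm.trans (Ideal.Quotient.eq_zero_iff_mem.2 hn)⟩
  · have : IsReduced (R ⧸ A) :=
      (Ideal.isRadical_iff_quotient_reduced _).1 (Ideal.radical_eq_iff.1 hAr)
    have hB (a b : R ⧸ A) : ∃ u v w, u * a = v * b ∧ (1 - u) * b = w * a := by
      obtain ⟨a, rfl⟩ := Ideal.Quotient.mk_surjective a
      obtain ⟨b, rfl⟩ := Ideal.Quotient.mk_surjective b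
      obtain ⟨u, v, w, h1, h2⟩ := hR.exists_mul_eq_mul a b
      refine ⟨Ideal.Quotient.mk A u, Ideal.Quotient.mk A v, Ideal.Quotient.mk A w, ?_, ?_⟩
      · rw [← map_mul, h1, map_mul]
      · rw [← map_one (Ideal.Quotient.mk A), ← map_sub, ← map_mul, h2, map_mul]
    exact Ideal.projective_of_fg_of_exists_mul_eq_mul hB
      (exists_mul_self_eq_of_exists_mul_eq_mul (hR A hA) hB) hI
end

section
/- Every commutative Bézout ring whose minimal prime spectrum MinSpec(R) is compact is an Hermite ring. -/
open DirectSum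

universe u

theorem exists_notMem_isNilpotent_mul_of_mem_minimalPrimes {R : Type*} [CommRing R]
    {P : Ideal R} (hP : P ∈ minimalPrimes R) {x : R} (hx : x ∈ P) :
    ∃ y ∉ P, IsNilpotent (x * y) := by
  have : P.IsPrime := hP.isPrime
  have h := IsLocalization.AtPrime.radical_map_of_mem_minimalPrimes
    (A := Localization.AtPrime P) P ⊥ hP
  have hmem : algebraMap R (Localization.AtPrime P) x ∈
      ((⊥ : Ideal R).map (algebraMap R (Localization.AtPrime P))).radical := by
    rw [h]
    exact Ideal.mem_map_of_mem _ hx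
  obtain ⟨n, hn⟩ := hmem
  rw [Ideal.map_bot, Ideal.mem_bot, ← map_pow,
    IsLocalization.map_eq_zero_iff P.primeCompl] at hn
  obtain ⟨y, hy⟩ := hn
  refine ⟨y, y.2, n + 1, ?_⟩
  calc (x * (y : R)) ^ (n + 1) = ((y : R) * x ^ n) * (x * (y : R) ^ n) := by ring
    _ = 0 := by rw [hy, zero_mul]

/-- In a Bézout ring with compact minimal spectrum every element has a complement modulo the
nilradical. -/
theorem exists_isNilpotent_mul_and_notMem_of_compact_minSpec {R : Type u} [CommRing R]
    [IsBezout R] [CompactSpace (MinSpec R)] (d : R) :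
    ∃ r : R, IsNilpotent (d * r) ∧ ∀ P ∈ minimalPrimes R, d + r ∉ P := by
  have hopen : ∀ x : R, IsOpen {P : MinSpec R | x ∉ P.1.asIdeal} := fun x ↦
    (PrimeSpectrum.basicOpen x).isOpen.preimage continuous_subtype_val
  have hclosed : IsClosed {P : MinSpec R | d ∈ P.1.asIdeal} := by
    have h := (hopen d).isClosed_compl
    simpa [Set.compl_def] using h
  obtain ⟨t, ht⟩ := hclosed.isCompact.elim_finite_subcover
    (fun r : {r : R // IsNilpotent (d * r)} ↦ {P : MinSpec R | (r : R) ∉ P.1.asIdeal})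
    (fun r ↦ hopen r) (by
      intro P hP
      obtain ⟨y, hy, hn⟩ := exists_notMem_isNilpotent_mul_of_mem_minimalPrimes P.2 hP
      exact Set.mem_iUnion.2 ⟨⟨y, hn⟩, hy⟩)
  classical
  let I : Ideal R := Ideal.span (t.image Subtype.val : Finset R)
  have hI : I.IsPrincipal := IsBezout.isPrincipal_of_FG I ⟨_, rfl⟩
  obtain ⟨r, hr⟩ := hI
  have hr' : I = Ideal.span {r} := hr
  have hdr : IsNilpotent (d * r) := by
    have hle : I ≤ Submodule.comap (LinearMap.mulLeft R d) (nilradical R) := by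
      refine Submodule.span_le.2 fun x hx ↦ ?_
      simp only [Finset.coe_image, Set.mem_image] at hx
      obtain ⟨y, -, rfl⟩ := hx
      exact mem_nilradical.2 y.2
    exact mem_nilradical.1 (hle (hr' ▸ Ideal.mem_span_singleton_self r))
  refine ⟨r, hdr, fun P hP hmem ↦ ?_⟩
  have hprime : P.IsPrime := hP.isPrime
  have hdP : d ∈ P ∧ r ∈ P := by
    have h0 : d * r ∈ P := nilradical_le_prime P (mem_nilradical.2 hdr)
    rcases hprime.mem_or_mem h0 with h | h
    · exact ⟨h, (P.add_mem_iff_right h).1 hmem⟩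
    · exact ⟨(P.add_mem_iff_left h).1 hmem, h⟩
  let Q : MinSpec R := ⟨⟨P, hprime⟩, hP⟩
  have hQ : Q ∈ {P : MinSpec R | d ∈ P.1.asIdeal} := hdP.1
  obtain ⟨y, hy, hyP⟩ := Set.mem_iUnion₂.1 (ht hQ)
  refine hyP ?_
  have hyI : (y : R) ∈ I := Ideal.subset_span (Finset.mem_image_of_mem _ hy)
  rw [hr'] at hyI
  exact (Ideal.span_singleton_le_iff_mem P).2 hdP.2 hyI

/-- In a Bézout ring, an element with a complement has annihilator generated by an
element `e` fixing the annihilator. -/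
theorem exists_mul_eq_zero_and_forall_mul_eq_self {S : Type*} [CommRing S] [IsBezout S]
    {d r : S} (hdr : d * r = 0) (hreg : ∀ w : S, w * (d + r) = 0 → w = 0) :
    ∃ e : S, d * e = 0 ∧ ∀ w : S, d * w = 0 → w * e = w := by
  obtain ⟨p, q, hpq⟩ := IsBezout.gcd_eq_sum d r
  obtain ⟨d', hd⟩ := IsBezout.gcd_dvd_left d r
  obtain ⟨r', hr⟩ := IsBezout.gcd_dvd_right d r
  set g := IsBezout.gcd d r
  have hg : ∀ w : S, g * w = 0 → w = 0 := fun w hw ↦ hreg w (by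
    linear_combination w * hd + w * hr + (d' + r') * hw)
  have hd'r' : d' * r' = 0 := hg _ (hg _ (by
    linear_combination hdr - r * hd - g * d' * hr))
  have hone : 1 - (d' * p + r' * q) = 0 := hg _ (by
    linear_combination - hpq + p * hd + q * hr)
  refine ⟨r' * q, by linear_combination r' * q * hd + g * q * hd'r', fun w hw ↦ ?_⟩
  have hwd' : d' * w = 0 := hg _ (by linear_combination hw - w * hd)
  linear_combination - w * hone - p * hwd'

theorem isHermiteRing_of_isBezout_of_forall_exists_complement {S : Type*} [CommRing S]
    [IsBezout S]
    (h : ∀ d : S, ∃ r : S, d * r = 0 ∧ ∀ w : S, w * (d + r) = 0 → w = 0) :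
    IsHermiteRing S := by
  intro a b
  obtain ⟨x, y, hxy⟩ := IsBezout.gcd_eq_sum a b
  obtain ⟨a₁, ha⟩ := IsBezout.gcd_dvd_left a b
  obtain ⟨b₁, hb⟩ := IsBezout.gcd_dvd_right a b
  set g := IsBezout.gcd a b
  obtain ⟨r, hgr, hreg⟩ := h g
  obtain ⟨e, hge, he⟩ := exists_mul_eq_zero_and_forall_mul_eq_self hgr hreg
  have hee := he e hge
  have hc := he (1 - (a₁ * x + b₁ * y)) (by
    linear_combination - hxy + x * ha + y * hb)
  refine ⟨g, (1 - e) * a₁ + e, (1 - e) * b₁, by linear_combination ha + (a₁ - 1) * hge,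
    by linear_combination hb + b₁ * hge, ?_⟩
  rw [Ideal.add_eq_sup, ← Ideal.isCoprime_iff_sup_eq, Ideal.isCoprime_span_singleton_iff]
  refine ⟨(1 - e) * x + e, (1 - e) * y, ?_⟩
  linear_combination (a₁ * x + b₁ * y - a₁ - x + 1) * hee + hc

/-- A Hermite ring has stable range at most two. -/
theorem IsHermiteRing.exists_isCoprime_add_mul {S : Type*} [CommRing S] (hS : IsHermiteRing S)
    {a b z x y w : S} (h : x * a + y * b + w * z = 1) :
    ∃ s t : S, IsCoprime (a + s * z) (b + t * z) := by
  obtain ⟨d, a', b', ha, hb, hab⟩ := hS a b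
  rw [Ideal.add_eq_sup, ← Ideal.isCoprime_iff_sup_eq, Ideal.isCoprime_span_singleton_iff] at hab
  obtain ⟨u, v, huv⟩ := hab
  have hd : (x * a' + y * b') * d + w * z = 1 := by
    linear_combination h - x * ha - y * hb
  refine ⟨-v, u, (x * a' + y * b') * u - w * b', (x * a' + y * b') * v + w * a', ?_⟩
  subst ha hb
  linear_combination hd + ((x * a' + y * b') * d + w * z) * huv

/-- The Hermite property lifts along a quotient by an ideal contained in the Jacobson radical,
for Bézout rings. -/
theorem isHermiteRing_of_quotient {R : Type*} [CommRing R] [IsBezout R] {I : Ideal R}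
    (hI : I ≤ Ideal.jacobson ⊥) (h : IsHermiteRing (R ⧸ I)) : IsHermiteRing R := by
  intro a b
  obtain ⟨x, y, hxy⟩ := IsBezout.gcd_eq_sum a b
  obtain ⟨a₁, ha⟩ := IsBezout.gcd_dvd_left a b
  obtain ⟨b₁, hb⟩ := IsBezout.gcd_dvd_right a b
  set g := IsBezout.gcd a b
  set z := 1 - (x * a₁ + y * b₁) with hz
  have hgz : g * z = 0 := by
    rw [hz]
    linear_combination - hxy + x * ha + y * hb
  let π := Ideal.Quotient.mk I
  have hone : π x * π a₁ + π y * π b₁ + 1 * π z = 1 := by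
    rw [hz]
    simp only [map_sub, map_add, map_mul, map_one]
    ring
  obtain ⟨s, t, u, v, huv⟩ := h.exists_isCoprime_add_mul hone
  obtain ⟨s, rfl⟩ := Ideal.Quotient.mk_surjective s
  obtain ⟨t, rfl⟩ := Ideal.Quotient.mk_surjective t
  obtain ⟨u, rfl⟩ := Ideal.Quotient.mk_surjective u
  obtain ⟨v, rfl⟩ := Ideal.Quotient.mk_surjective v
  have hmem : u * (a₁ + s * z) + v * (b₁ + t * z) - 1 ∈ I := by
    rw [← Ideal.Quotient.eq]
    simpa [π] using huv
  obtain ⟨c, hc⟩ : IsUnit (u * (a₁ + s * z) + v * (b₁ + t * z)) := by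
    simpa using Ideal.mem_jacobson_bot.1 (hI hmem) 1
  refine ⟨g, a₁ + s * z, b₁ + t * z, by linear_combination ha - s * hgz,
    by linear_combination hb - t * hgz, ?_⟩
  rw [Ideal.add_eq_sup, ← Ideal.isCoprime_iff_sup_eq, Ideal.isCoprime_span_singleton_iff]
  refine ⟨↑c⁻¹ * u, ↑c⁻¹ * v, ?_⟩
  linear_combination - (↑c⁻¹ : R) * hc + c.inv_mul

/-- Every commutative Bézout ring with compact minimal prime spectrum
is an Hermite ring. -/
theorem isHermiteRing_of_isBezout_of_compact_minSpec (R : Type u) [CommRing R]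
    [IsBezout R] (hmin : CompactSpace (MinSpec R)) : IsHermiteRing R := by
  have hsurj := Ideal.Quotient.mk_surjective (I := nilradical R)
  have : IsBezout (R ⧸ nilradical R) := hsurj.isBezout
  refine isHermiteRing_of_quotient (I := nilradical R) Ideal.radical_le_jacobson
    (isHermiteRing_of_isBezout_of_forall_exists_complement fun d ↦ ?_)
  obtain ⟨d, rfl⟩ := hsurj d
  obtain ⟨r, hdr, hr⟩ := exists_isNilpotent_mul_and_notMem_of_compact_minSpec d
  refine ⟨Ideal.Quotient.mk _ r, ?_, fun w hw ↦ ?_⟩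
  · rw [← map_mul, Ideal.Quotient.eq_zero_iff_mem]
    exact hdr
  · obtain ⟨w, rfl⟩ := hsurj w
    rw [← map_add, ← map_mul, Ideal.Quotient.eq_zero_iff_mem] at hw
    rw [Ideal.Quotient.eq_zero_iff_mem, nilradical, ← Ideal.sInf_minimalPrimes]
    refine Submodule.mem_sInf.2 fun P hP ↦ ?_
    have : Ideal.IsPrime P := hP.isPrime
    exact (this.mem_or_mem (nilradical_le_prime P hw)).resolve_right (hr P hP)
end
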